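/- Let 𝔽_q be a finite field of characteristic p and let φ ∈ 𝔽_q(x) have degree d with 2 ≤ d < p. For each n ≥ 1, let F_n(x) be the numerator of φ^n(x) − t, let K_n^arith (resp. K_n^geom) be its splitting field over 𝔽_q(t) (resp. over 𝔽̄_q(t)), let G_n = Gal(K_n^geom / 𝔽̄_q(t)) acting on the d^n roots of F_n, and set FPP(pgIMG(φ)/𝔽_q) = lim_{n→∞} FPP(G_n). Then liminf_{k→∞} #Per(φ, ℙ¹(𝔽_{q^k}))/(q^k + 1) ≤ FPP(pgIMG(φ)/𝔽_q). If in addition K_n^arith is geometric over 𝔽_q(t) (i.e. K_n^arith ∩ 𝔽̄_q = 𝔽_q) for all n ≥ 1, then limsup_{k→∞} #Per(φ, ℙ¹(𝔽_{q^k}))/(q^k + 1) ≤ FPP(pgIMG(φ)/𝔽_q). -/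

import Mathlib

open Polynomial

/-- Composition of the pair `(p, q)` (representing `p/q`) with the pair `(r, s)`:
homogenization of the substitution `x ↦ r/s`, giving a pair representing
`(p/q) ∘ (r/s)`. -/
noncomputable def pairComp {K : Type*} [CommRing K] (p q r s : Polynomial K) :
    Polynomial K × Polynomial K :=
  (∑ i ∈ Finset.range (max p.natDegree q.natDegree + 1),
      C (p.coeff i) * r ^ i * s ^ (max p.natDegree q.natDegree - i),
   ∑ i ∈ Finset.range (max p.natDegree q.natDegree + 1),
      C (q.coeff i) * r ^ i * s ^ (max p.natDegree q.natDegree - i))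

/-- The pair `(p_n, q_n)` representing the `n`-th iterate `φ^n = p_n/q_n` of the
rational function `φ = p/q` (with `φ^0 = x`). -/
noncomputable def iterPair {K : Type*} [CommRing K] (p q : Polynomial K) :
    ℕ → Polynomial K × Polynomial K
  | 0 => (X, 1)
  | n + 1 => pairComp p q (iterPair p q n).1 (iterPair p q n).2

/-- The numerator of `φ^n(x) - t` as a polynomial in `x` over the function field
`F(t) = RatFunc F`: namely `p_n(x) - t · q_n(x)` where `φ^n = p_n/q_n`. -/
noncomputable def PhiPoly (F : Type*) [Field F] (p q : Polynomial F) (n : ℕ) :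
    Polynomial (RatFunc F) :=
  ((iterPair p q n).1).map (RatFunc.C : F →+* RatFunc F)
    - Polynomial.C RatFunc.X * ((iterPair p q n).2).map (RatFunc.C : F →+* RatFunc F)

/-- `x` is algebraic over `A` (with respect to the ring map `σ : A →+* B`). -/
def algebraicOver {A B : Type*} [CommRing A] [CommRing B] (σ : A →+* B) (x : B) : Prop :=
  ∃ P : Polynomial A, P ≠ 0 ∧ Polynomial.eval₂ σ x P = 0



open Classical in
/-- The self-map of `ℙ¹(Ω) = Ω ∪ {∞}` (modeled as `Option Ω`, with `none = ∞`)
induced by the rational function `p/q`, where `p q : Polynomial Ω` are assumed coprime. -/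
noncomputable def ratMapP1 {Ω : Type*} [Field Ω] (p q : Polynomial Ω) : Option Ω → Option Ω :=
  fun z => match z with
  | some a => if q.eval a = 0 then none else some (p.eval a / q.eval a)
  | none =>
      if q.natDegree < p.natDegree then none
      else if p.natDegree < q.natDegree then some 0
      else some (p.leadingCoeff / q.leadingCoeff)

open Classical in
/-- The Möbius transformation `z ↦ (a z + b)/(c z + d)` of `ℙ¹(Ω)`, for an
invertible matrix `(a b; c d)`. -/
noncomputable def mobiusMap {Ω : Type*} [Field Ω] (a b c d : Ω) : Option Ω → Option Ω :=
  fun z => match z with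
  | some x => if c * x + d = 0 then none else some ((a * x + b) / (c * x + d))
  | none => if c = 0 then none else some (a / c)

open Classical in
/-- The ramification index of the rational function `p/q` at a finite point `x`. -/
noncomputable def ramAt {Ω : Type*} [Field Ω] (p q : Polynomial Ω) (x : Ω) : ℕ :=
  if q.eval x = 0 then Polynomial.rootMultiplicity x q
  else Polynomial.rootMultiplicity x (p - C (p.eval x / q.eval x) * q)

/-- The ramification index `e_{p/q}(α)` of the rational function `p/q` at a point
`α ∈ ℙ¹(Ω)`; the index at `∞` is computed from the reversed polynomials. -/
noncomputable def ramIdxP1 {Ω : Type*} [Field Ω] (p q : Polynomial Ω) : Option Ω → ℕ :=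
  fun z => match z with
  | some x => ramAt p q x
  | none =>
      ramAt (p.reverse * X ^ (max p.natDegree q.natDegree - p.natDegree))
            (q.reverse * X ^ (max p.natDegree q.natDegree - q.natDegree)) 0

/-- The set of critical points in `ℙ¹(Ω)` of the rational function `p/q`. -/
def critSetP1 {Ω : Type*} [Field Ω] (p q : Polynomial Ω) : Set (Option Ω) :=
  {α | 1 < ramIdxP1 p q α}

/-- The post-critical set `P_φ = ⋃_{k ≥ 1} φ^k(C_φ)` of `φ = p/q`. -/
def postCritP1 {Ω : Type*} [Field Ω] (p q : Polynomial Ω) : Set (Option Ω) :=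
  ⋃ k : ℕ, (ratMapP1 p q)^[k + 1] '' critSetP1 p q

/-- `φ = p/q` is a Lattès map: there is `r : ℙ¹(Ω) → ℤ` with
`r(φ(α)) = e_φ(α) · r(α)` for all `α` and `r(α) = 1` outside the post-critical set. -/
def IsLattesPair {Ω : Type*} [Field Ω] (p q : Polynomial Ω) : Prop :=
  ∃ r : Option Ω → ℤ,
    (∀ α : Option Ω, r (ratMapP1 p q α) = ramIdxP1 p q α * r α) ∧
    ∀ α : Option Ω, α ∉ postCritP1 p q → r α = 1

/-- The rational maps `p/q` and `r/s` are Möbius-conjugate over `Ω`: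
`(r/s) ∘ μ = μ ∘ (p/q)` on `ℙ¹(Ω)` for some Möbius transformation `μ`. -/
def MobiusConjugate {Ω : Type*} [Field Ω] (p q r s : Polynomial Ω) : Prop :=
  ∃ a b c d : Ω, a * d - b * c ≠ 0 ∧
    ∀ z : Option Ω, ratMapP1 r s (mobiusMap a b c d z) = mobiusMap a b c d (ratMapP1 p q z)

/-- `φ = p/q` is dynamically exceptional: there is a finite nonempty
`Γ ⊆ ℙ¹(Ω)` with `φ⁻¹(Γ) \ C_φ = Γ`. -/
def DynExceptional {Ω : Type*} [Field Ω] (p q : Polynomial Ω) : Prop :=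
  ∃ Γ : Set (Option Ω), Γ.Finite ∧ Γ.Nonempty ∧
    (ratMapP1 p q) ⁻¹' Γ \ critSetP1 p q = Γ

/-- The number of points of `ℙ¹(𝔽_{q^N})` (realized inside `ℙ¹` of the algebraic
closure of `F`, where `q = #F`) that are periodic under the rational map `p/q`. -/
noncomputable def perCount (F : Type*) [Field F] [Fintype F] (p q : Polynomial F)
    (N : ℕ) : ℕ :=
  Set.ncard {α : Option (AlgebraicClosure F) |
    (α = none ∨ ∃ a : AlgebraicClosure F, α = some a ∧ a ^ Fintype.card F ^ N = a) ∧
    ∃ m : ℕ, 1 ≤ m ∧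
      (ratMapP1 (p.map (algebraMap F (AlgebraicClosure F)))
        (q.map (algebraMap F (AlgebraicClosure F))))^[m] α = α}

open Polynomial

/-- The fixed point proportion of the geometric Galois group
`G_n = Gal(K_n^geom / 𝔽̄_q(t))` acting on the roots of the numerator of
`φ^n(x) - t` over `𝔽̄_q(t)`. -/
noncomputable def FPPgeo (F : Type*) [Field F] (p q : Polynomial F) (n : ℕ) : ℝ :=
  (Nat.card {g : (PhiPoly (AlgebraicClosure F) (p.map (algebraMap F (AlgebraicClosure F)))
        (q.map (algebraMap F (AlgebraicClosure F))) n).Gal //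
      ∃ r ∈ (PhiPoly (AlgebraicClosure F) (p.map (algebraMap F (AlgebraicClosure F)))
          (q.map (algebraMap F (AlgebraicClosure F))) n).rootSet
          (PhiPoly (AlgebraicClosure F) (p.map (algebraMap F (AlgebraicClosure F)))
            (q.map (algebraMap F (AlgebraicClosure F))) n).SplittingField, g r = r} : ℝ)
    / (Nat.card (PhiPoly (AlgebraicClosure F) (p.map (algebraMap F (AlgebraicClosure F)))
        (q.map (algebraMap F (AlgebraicClosure F))) n).Gal : ℝ)

/-- A filtration of a `k`-algebra by finite-dimensional subspaces whose dimensions grow linearly. -/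
structure LinearFiltration (k A : Type*) [Field k] [CommRing A] [Algebra k A] where
  V : ℕ → Submodule k A
  N : ℕ
  c : ℕ
  N_pos : 0 < N
  finite : ∀ m, FiniteDimensional k (V m)
  mul_mem : ∀ {m n : ℕ} {a b : A}, a ∈ V m → b ∈ V n → a * b ∈ V (m + n)
  exhaust : ∀ a : A, ∃ m₀, ∀ m ≥ m₀, a ∈ V m
  le_finrank : ∀ m, N * m ≤ Module.finrank k (V m) + c
  finrank_le : ∀ m, Module.finrank k (V m) ≤ N * m + c

namespace LinearFiltration

variable {k A : Type*} [Field k] [CommRing A] [Algebra k A]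

theorem pow_mem (Φ : LinearFiltration k A) {m : ℕ} {a : A} (ha : a ∈ Φ.V m) :
    ∀ {n : ℕ}, 0 < n → a ^ n ∈ Φ.V (m * n)
  | 0, h => absurd h (lt_irrefl 0)
  | 1, _ => by simpa using ha
  | n + 2, _ => by
    have := Φ.mul_mem (Φ.pow_mem ha (Nat.succ_pos n)) ha
    rwa [← pow_succ, ← Nat.mul_succ] at this

/-- The codimension of the ideal generated by an element of `V l` is at most `N l + 2 c`. -/
theorem card_le_of_mul_eq_zero [IsDomain A] (Φ : LinearFiltration k A) {W : Type*}
    [AddCommGroup W] [Module k W] (T : A →ₗ[k] W) {l : ℕ} {a : A} (ha : a ∈ Φ.V l) (ha0 : a ≠ 0)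
    (hT : ∀ b, T (a * b) = 0) {r : ℕ} (f : Fin r → A) (hf : LinearIndependent k (T ∘ f)) :
    r ≤ Φ.N * l + 2 * Φ.c := by
  choose m₀ hm₀ using Φ.exhaust
  set M := Finset.univ.sup fun i => m₀ (f i)
  have hfM : ∀ i, f i ∈ Φ.V (l + M) := fun i =>
    hm₀ _ _ ((Finset.le_sup (f := fun i => m₀ (f i)) (Finset.mem_univ i)).trans (Nat.le_add_left _ _))
  have := Φ.finite
  let T' : Φ.V (l + M) →ₗ[k] W := T.domRestrict (Φ.V (l + M))
  have hrange : r ≤ Module.finrank k (LinearMap.range T') := by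
    have hli : LinearIndependent k
        (fun i => (⟨T (f i), ⟨⟨f i, hfM i⟩, rfl⟩⟩ : LinearMap.range T')) :=
      LinearIndependent.of_comp (LinearMap.range T').subtype hf
    simpa using hli.fintype_card_le_finrank
  have hker : Module.finrank k (Φ.V M) ≤ Module.finrank k (LinearMap.ker T') := by
    let j : Φ.V M →ₗ[k] LinearMap.ker T' :=
      LinearMap.codRestrict _ (LinearMap.codRestrict _
        ((LinearMap.mulLeft k a).domRestrict (Φ.V M)) (fun b => Φ.mul_mem ha b.2))
        (fun b => hT b)
    refine LinearMap.finrank_le_finrank_of_injective (f := j) fun x y hxy => ?_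
    have h : a * (x : A) = a * y :=
      congrArg (fun z : LinearMap.ker T' => ((z : Φ.V (l + M)) : A)) hxy
    exact Subtype.ext (mul_left_cancel₀ ha0 h)
  have h1 := LinearMap.finrank_range_add_finrank_ker T'
  have h2 := Φ.finrank_le (l + M)
  have h3 := Φ.le_finrank M
  rw [mul_add] at h2
  lia

end LinearFiltration

/-- Finitely many distinct characters can be interpolated. -/
theorem exists_interpolation {k A ι : Type*} [Field k] [CommRing A] [Algebra k A] [Finite ι]
    [DecidableEq ι]
    (ψ : ι → A →ₐ[k] k) (hψ : Function.Injective ψ) :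
    ∃ f : ι → A, ∀ i j, ψ j (f i) = if i = j then 1 else 0 := by
  cases nonempty_fintype ι
  have key : ∀ i j, ∃ h : A, i ≠ j → ψ i h = 1 ∧ ψ j h = 0 := by
    intro i j
    by_cases hij : i = j
    · exact ⟨0, fun h => absurd hij h⟩
    · obtain ⟨a, ha⟩ : ∃ a, ψ i a ≠ ψ j a := by
        by_contra! hcon
        exact hij (hψ (AlgHom.ext hcon))
      refine ⟨(ψ i a - ψ j a)⁻¹ • (a - algebraMap k A (ψ j a)), fun _ => ⟨?_, ?_⟩⟩
      · simp [inv_mul_cancel₀ (sub_ne_zero.2 ha)]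
      · simp
  choose h hh using key
  refine ⟨fun i => ∏ j ∈ Finset.univ.erase i, h i j, fun i j => ?_⟩
  rw [map_prod]
  split_ifs with hij
  · subst hij
    exact Finset.prod_eq_one fun l hl => (hh i l (Finset.ne_of_mem_erase hl).symm).1
  · exact Finset.prod_eq_zero (Finset.mem_erase.2 ⟨Ne.symm hij, Finset.mem_univ j⟩) (hh i j hij).2

namespace LinearFiltration

variable {k A : Type*} [Field k] [CommRing A] [Algebra k A] [IsDomain A]

/-- An element of `V l` vanishes at no more than `N l + 2 c` points. -/
theorem card_zeros_le (Φ : LinearFiltration k A) {l : ℕ} {a : A} (ha : a ∈ Φ.V l) (ha0 : a ≠ 0)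
    (S : Finset (A →ₐ[k] k)) (hS : ∀ ψ ∈ S, ψ a = 0) : S.card ≤ Φ.N * l + 2 * Φ.c := by
  classical
  let e := S.equivFin.symm
  obtain ⟨f, hf⟩ := exists_interpolation (fun i => (e i : A →ₐ[k] k))
    (Subtype.val_injective.comp e.injective)
  refine Φ.card_le_of_mul_eq_zero (LinearMap.pi fun i => (e i : A →ₐ[k] k).toLinearMap) ha ha0
    (fun b => ?_) f ?_
  · ext i
    simp [hS _ (e i).2]
  · have : (LinearMap.pi fun i => (e i : A →ₐ[k] k).toLinearMap) ∘ f =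
        fun i => Pi.single i (1 : k) := by
      ext i j
      simp [hf, Pi.single_apply, eq_comm]
    rw [this]
    exact Pi.linearIndependent_single_one (Fin S.card) k

/-- An element of `V l` vanishes to order at most `N l + 2 c` along a nonzero proper ideal. -/
theorem order_le [IsNoetherianRing A] (Φ : LinearFiltration k A) {l : ℕ} {a : A}
    (ha : a ∈ Φ.V l) (ha0 : a ≠ 0) (P : Ideal A) (hP : P ≠ ⊤) (hP0 : P ≠ ⊥) {r : ℕ}
    (har : a ∈ P ^ r) : r ≤ Φ.N * l + 2 * Φ.c := by
  have hstrict : ∀ i, ∃ f ∈ P ^ i, f ∉ P ^ (i + 1) := by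
    intro i
    by_contra! hcon
    have heq : P ^ i = P ^ (i + 1) := le_antisymm hcon (Ideal.pow_le_pow_right (Nat.le_succ i))
    have hall : ∀ j, P ^ i ≤ P ^ (i + j) := by
      intro j
      induction j with
      | zero => rfl
      | succ j ih =>
        calc P ^ i = P ^ i * P := by rw [← pow_succ, ← heq]
          _ ≤ P ^ (i + j) * P := Ideal.mul_mono_left ih
          _ = P ^ (i + (j + 1)) := by rw [← pow_succ, add_assoc]
    have hbot : P ^ i ≤ ⊥ := by
      rw [← Ideal.iInf_pow_eq_bot_of_isDomain P hP]
      exact le_iInf fun j => (hall j).trans (Ideal.pow_le_pow_right (Nat.le_add_left j i))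
    exact hP0 (eq_zero_of_pow_eq_zero (le_bot_iff.1 hbot))
  choose f hf hf' using hstrict
  let T : A →ₗ[k] A ⧸ P ^ r := (Ideal.Quotient.mkₐ k (P ^ r)).toLinearMap
  refine Φ.card_le_of_mul_eq_zero T ha ha0 (fun b => ?_) (fun i : Fin r => f i) ?_
  · exact Ideal.Quotient.eq_zero_iff_mem.2 (Ideal.mul_mem_right _ _ har)
  · rw [Fintype.linearIndependent_iff]
    intro g hg
    have hsum : ∑ i : Fin r, g i • f i ∈ P ^ r := by
      rw [← Ideal.Quotient.eq_zero_iff_mem, ← hg]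
      simp [T, Algebra.smul_def]
    have hind : ∀ n, ∀ i : Fin r, (i : ℕ) = n → g i = 0 := by
      intro n
      induction n using Nat.strong_induction_on with
      | _ n ih =>
        intro i hi
        by_contra hgi
        have hmem : g i • f i ∈ P ^ ((i : ℕ) + 1) := by
          have hsplit := Finset.add_sum_erase Finset.univ (fun i : Fin r => g i • f i)
            (Finset.mem_univ i)
          rw [← eq_sub_iff_add_eq] at hsplit
          rw [hsplit]
          refine sub_mem (Ideal.pow_le_pow_right i.2 hsum) (sum_mem fun j hj => ?_)
          rcases lt_or_gt_of_ne (Fin.val_ne_of_ne (Finset.ne_of_mem_erase hj)) with hlt | hlt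
          · rw [ih j (hi ▸ hlt) j rfl, zero_smul]
            exact zero_mem _
          · rw [Algebra.smul_def]
            exact Ideal.mul_mem_left _ _ (Ideal.pow_le_pow_right hlt (hf j))
        apply hf' i
        have := Ideal.mul_mem_left (P ^ ((i : ℕ) + 1)) (algebraMap k A (g i)⁻¹) hmem
        rwa [Algebra.smul_def, ← mul_assoc, ← map_mul, inv_mul_cancel₀ hgi, map_one,
          one_mul] at this
    exact fun i => hind i i rfl

end LinearFiltration

/-- A finite-dimensional space of functions on which points separate elements has a basis dual to
some family of points. -/
theorem exists_dual_points {k A : Type*} [Field k] [CommRing A] [Algebra k A]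
    (hsep : ∀ a : A, a ≠ 0 → ∃ ψ : A →ₐ[k] k, ψ a ≠ 0) (V : Submodule k A)
    [FiniteDimensional k V] :
    ∃ (ψ : Fin (Module.finrank k V) → A →ₐ[k] k) (s : Fin (Module.finrank k V) → A),
      (∀ i, s i ∈ V) ∧ ∀ i j, ψ j (s i) = if i = j then 1 else 0 := by
  let R : Set (Module.Dual k V) :=
    Set.range fun ψ : A →ₐ[k] k => ψ.toLinearMap.domRestrict V
  have hcoann : (Submodule.span k R).dualCoannihilator = ⊥ := by
    rw [eq_bot_iff]
    intro v hv
    by_contra hv0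
    obtain ⟨ψ, hψ⟩ := hsep v (fun h => hv0 (Subtype.ext h))
    exact hψ ((Submodule.mem_dualCoannihilator _).1 hv _ (Submodule.subset_span ⟨ψ, rfl⟩))
  have hspan : Submodule.span k R = ⊤ := by
    rw [← Subspace.dualCoannihilator_dualAnnihilator_eq (W := Submodule.span k R), hcoann]
    simp
  obtain ⟨f, hfR, hfspan, hfli⟩ := Submodule.exists_fun_fin_finrank_span_eq k R
  have hr : Module.finrank k (Submodule.span k R) = Module.finrank k V := by
    rw [hspan, finrank_top, Subspace.dual_finrank_eq]
  rw [← hr]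
  choose ψ hψ using hfR
  let B : Module.Basis _ k (Module.Dual k V) := Module.Basis.mk hfli (by rw [hfspan, hspan])
  refine ⟨ψ, fun i => ((Module.evalEquiv k V).symm (B.dualBasis i) : V), fun i => Subtype.mem _, ?_⟩
  intro i j
  have h1 : ψ j ((Module.evalEquiv k V).symm (B.dualBasis i) : V) =
      f j ((Module.evalEquiv k V).symm (B.dualBasis i)) := by
    rw [← hψ j]; rfl
  rw [h1, Module.apply_evalEquiv_symm_apply]
  have : f j = B j := by simp [B]
  rw [this, Module.Basis.dualBasis_apply_self]
  simp [eq_comm]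

namespace LinearFiltration

variable {k A : Type*} [Field k] [CommRing A] [Algebra k A] [IsDomain A]

/-- Existence of a nontrivial relation with `p`-power coefficients, by counting dimensions. -/
theorem exists_relation (Φ : LinearFiltration k A) (p : ℕ) [Fact p.Prime] [CharP k p] [CharP A p]
    [PerfectRing k p] (μ : ℕ) {r l M : ℕ} (u : Fin r → A)
    (hu : ∀ a ∈ Φ.V l, ∀ i, a ^ p ^ μ * u i ∈ Φ.V M)
    (hlt : Module.finrank k (Φ.V M) < r * Module.finrank k (Φ.V l)) :
    ∃ a : Fin r → A, (∀ i, a i ∈ Φ.V l) ∧ a ≠ 0 ∧ ∑ i, a i ^ p ^ μ * u i = 0 := by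
  by_contra! hcon
  have := Φ.finite
  let j : (Fin r → Φ.V l) →+ Φ.V M :=
    { toFun := fun a => ⟨∑ i, (a i : A) ^ p ^ μ * u i, sum_mem fun i _ => hu _ (a i).2 i⟩
      map_zero' := by
        ext
        simp [(Fact.out : p.Prime).ne_zero]
      map_add' := fun a b => by
        ext
        simp [add_pow_char_pow, add_mul, Finset.sum_add_distrib] }
  have hj : Function.Injective j := by
    rw [injective_iff_map_eq_zero]
    intro a ha
    by_contra ha0
    refine hcon (fun i => a i) (fun i => (a i).2) (fun h => ha0 ?_) (congrArg Subtype.val ha)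
    ext i
    exact congrFun h i
  have hrank := rank_le_of_surjective_injective (fun c : k => c ^ p ^ μ) j
    (bijective_iterateFrobenius k p μ).2 hj (fun c a => by
      ext
      simp [j, Finset.smul_sum, _root_.smul_pow])
  have h := Cardinal.toNat_le_toNat hrank (Module.rank_lt_aleph0 _ _)
  change Module.finrank k (Fin r → Φ.V l) ≤ Module.finrank k (Φ.V M) at h
  rw [Module.finrank_pi_fintype] at h
  simp at h
  lia

/-- Stepanov's method: a bound for the number of points on which the `p ^ (μ + ν)`-power Frobenius
agrees with a given semilinear endomorphism. -/
theorem card_frobenius_points_le [IsNoetherianRing A] (Φ : LinearFiltration k A) (p : ℕ)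
    [Fact p.Prime] [CharP k p] [CharP A p] [PerfectRing k p]
    (hsep : ∀ a : A, a ≠ 0 → ∃ ψ : A →ₐ[k] k, ψ a ≠ 0)
    (hfield : ∀ ψ : A →ₐ[k] k, RingHom.ker ψ ≠ ⊥)
    {l m e μ ν : ℕ} (ρ : A →+* A) (hρ : ∀ a ∈ Φ.V m, ρ a ∈ Φ.V (m + e))
    (hdim : Φ.N * (l * p ^ μ + (m + e)) + Φ.c <
      Module.finrank k (Φ.V m) * Module.finrank k (Φ.V l))
    (hν : Φ.N * l + 2 * Φ.c < p ^ ν)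
    (S : Finset (A →ₐ[k] k)) (hS : ∀ ψ ∈ S, ∀ a, ψ a ^ p ^ (μ + ν) = ψ (ρ a)) :
    S.card ≤ Φ.N * (l + m * p ^ ν) + 2 * Φ.c := by
  have := Φ.finite
  have hp : 0 < p := (Fact.out : p.Prime).pos
  obtain ⟨χ, s, hsV, hs⟩ := exists_dual_points hsep (Φ.V m)
  obtain ⟨a, haV, ha0, ha⟩ := Φ.exists_relation p μ (l := l) (M := l * p ^ μ + (m + e))
    (fun i => ρ (s i))
    (fun a ha i => Φ.mul_mem (Φ.pow_mem ha (pow_pos hp μ)) (hρ _ (hsV i)))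
    ((Φ.finrank_le _).trans_lt hdim)
  refine Φ.card_zeros_le (a := ∑ i, a i * s i ^ p ^ ν)
    (sum_mem fun i _ => Φ.mul_mem (haV i) (Φ.pow_mem (hsV i) (pow_pos hp ν))) (fun h0 => ?_) S
    (fun ψ hψ => ?_)
  · obtain ⟨j, hj⟩ := Function.ne_iff.1 ha0
    have hsub : ∀ i, s i - (if i = j then 1 else 0) ∈ RingHom.ker (χ j) := by
      intro i
      rw [RingHom.mem_ker, map_sub, hs]
      split_ifs <;> simp
    have hmem : a j ∈ RingHom.ker (χ j) ^ p ^ ν := by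
      have h1 : a j = - ∑ i, a i * (s i - (if i = j then 1 else 0)) ^ p ^ ν := by
        have h2 : ∀ i, a i * (s i - (if i = j then 1 else 0)) ^ p ^ ν =
            a i * s i ^ p ^ ν - (if i = j then a j else 0) := by
          intro i
          rw [sub_pow_char_pow]
          split_ifs with h
          · rw [h]; ring
          · simp [hp.ne']
        simp_rw [h2, Finset.sum_sub_distrib, h0]
        simp
      rw [h1]
      exact neg_mem (sum_mem fun i _ => Ideal.mul_mem_left _ _ (Ideal.pow_mem_pow (hsub i) _))
    have := Φ.order_le (haV j) hj (RingHom.ker (χ j)) (RingHom.ker_ne_top _) (hfield _) hmem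
    lia
  · refine eq_zero_of_pow_eq_zero (n := p ^ μ) ?_
    rw [← map_pow, sum_pow_char_pow, ← map_zero ψ, ← ha, map_sum, map_sum]
    refine Finset.sum_congr rfl fun i _ => ?_
    rw [map_mul, ← hS ψ hψ, mul_pow, map_mul, map_pow ψ (s i ^ p ^ ν), map_pow ψ (s i), ← pow_mul,
      pow_add, mul_comm (p ^ ν)]

/-- Asymptotic form of Stepanov's bound, with constants independent of the Frobenius power. -/
theorem exists_card_frobenius_points_mul_le [IsNoetherianRing A] (Φ : LinearFiltration k A) (p : ℕ)
    [Fact p.Prime] [CharP k p] [CharP A p] [PerfectRing k p]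
    (hsep : ∀ a : A, a ≠ 0 → ∃ ψ : A →ₐ[k] k, ψ a ≠ 0)
    (hfield : ∀ ψ : A →ₐ[k] k, RingHom.ker ψ ≠ ⊥) (e μ : ℕ) :
    ∃ C i₀ : ℕ, ∀ i ≥ i₀, ∀ ρ : A →+* A, (∀ m, ∀ a ∈ Φ.V m, ρ a ∈ Φ.V (m + e)) →
      ∀ S : Finset (A →ₐ[k] k), (∀ ψ ∈ S, ∀ a, ψ a ^ p ^ i = ψ (ρ a)) →
        S.card * p ^ μ ≤ (p ^ μ + (Φ.c + Φ.N + 1)) * p ^ i + C := by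
  have hp : 1 < p := (Fact.out : p.Prime).one_lt
  set w := p ^ μ
  set N := Φ.N
  set c := Φ.c
  set m := (w + 1 + c) / N + 1 with hm
  set l := c * (w + 1) + N * (m + e) + c + 1 with hl
  have hN : 0 < N := Φ.N_pos
  have hm1 : w + 1 + c ≤ N * m := by
    have := Nat.lt_mul_div_succ (w + 1 + c) hN
    exact this.le
  have hm2 : N * m ≤ w + 1 + c + N := by
    have := Nat.mul_div_le (w + 1 + c) N
    rw [hm, mul_add]
    lia
  obtain ⟨ν₀, hν₀⟩ : ∃ ν₀, N * l + 2 * c < p ^ ν₀ := ⟨_, Nat.lt_pow_self hp⟩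
  refine ⟨(N * l + 2 * c) * w, μ + ν₀, fun i hi ρ hρ S hS => ?_⟩
  obtain ⟨ν, rfl⟩ : ∃ ν, i = μ + ν := ⟨i - μ, by lia⟩
  have hν : p ^ ν₀ ≤ p ^ ν := Nat.pow_le_pow_right hp.le (by lia)
  have hdim : N * (l * w + (m + e)) + c <
      Module.finrank k (Φ.V m) * Module.finrank k (Φ.V l) := by
    have h1 : w + 1 ≤ Module.finrank k (Φ.V m) := by
      have := Φ.le_finrank m
      lia
    have h2 : N * l ≤ Module.finrank k (Φ.V l) + c := Φ.le_finrank l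
    have h3 := Nat.mul_le_mul_right (Module.finrank k (Φ.V l)) h1
    have h4 := Nat.mul_le_mul_left (w + 1) h2
    have h5 : l ≤ N * l := Nat.le_mul_of_pos_left _ hN
    nlinarith
  have := Φ.card_frobenius_points_le p hsep hfield ρ (hρ m) hdim (hν₀.trans_le hν) S hS
  calc S.card * w ≤ (N * (l + m * p ^ ν) + 2 * c) * w := Nat.mul_le_mul_right _ this
    _ = (N * m) * (w * p ^ ν) + (N * l + 2 * c) * w := by ring
    _ ≤ (w + 1 + c + N) * (w * p ^ ν) + (N * l + 2 * c) * w := by gcongr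
    _ = (w + (c + N + 1)) * p ^ (μ + ν) + (N * l + 2 * c) * w := by rw [pow_add]; ring

end LinearFiltration

theorem Polynomial.mem_degreeLT_iff_natDegree {k : Type*} [Semiring k] {n : ℕ} {f : k[X]} :
    f ∈ degreeLT k n ↔ f = 0 ∨ f.natDegree < n := by
  rw [mem_degreeLT]
  by_cases hf : f = 0
  · simp [hf]
  · simp [hf, natDegree_lt_iff_degree_lt hf]

theorem Polynomial.mul_mul_mem_degreeLT {k : Type*} [Semiring k] {m n e : ℕ} {f g h : k[X]}
    (hf : f ∈ degreeLT k (m + 1 - e)) (hg : g ∈ degreeLT k (n + 1 - e)) (hh : h.natDegree ≤ e) :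
    f * g * h ∈ degreeLT k (m + n + 1 - e) := by
  rw [mem_degreeLT_iff_natDegree] at hf hg ⊢
  rcases hf with rfl | hf
  · simp
  rcases hg with rfl | hg
  · simp
  right
  have h1 := natDegree_mul_le (p := f * g) (q := h)
  have h2 := natDegree_mul_le (p := f) (q := g)
  lia

theorem Polynomial.mul_mem_degreeLT_add {k : Type*} [Semiring k] {m e e' : ℕ} {f h : k[X]}
    (hf : f ∈ degreeLT k (m + 1 - e)) (hh : h.natDegree ≤ e') :
    f * h ∈ degreeLT k (m + e' + 1 - e) := by
  rw [mem_degreeLT_iff_natDegree] at hf ⊢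
  rcases hf with rfl | hf
  · simp
  right
  have h1 := natDegree_mul_le (p := f) (q := h)
  lia

section BasisFiltration

variable {k A : Type*} [Field k] [CommRing A] [Algebra k A] [Algebra k[X] A]
  [IsScalarTower k k[X] A]

/-- The elements whose coordinates in a `k[X]`-basis have degree less than `n`. -/
noncomputable def coordDegreeLT {ι : Type*} [Fintype ι] (b : Module.Basis ι k[X] A) (n : ℕ) :
    Submodule k A :=
  (Submodule.pi Set.univ fun _ : ι => degreeLT k n).comap
    (b.equivFun.restrictScalars k).toLinearMap

theorem mem_coordDegreeLT {ι : Type*} [Fintype ι] (b : Module.Basis ι k[X] A) {n : ℕ} {a : A} :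
    a ∈ coordDegreeLT b n ↔ ∀ i, b.repr a i ∈ degreeLT k n := by
  simp [coordDegreeLT, Submodule.mem_pi]

/-- Coordinates of bounded degree are the same as tuples of coefficients. -/
noncomputable def coordDegreeLTEquiv {ι : Type*} [Fintype ι] (b : Module.Basis ι k[X] A) (n : ℕ) :
    coordDegreeLT b n ≃ₗ[k] (ι → Fin n → k) :=
  LinearEquiv.trans
    { toFun := fun a i => ⟨b.repr a i, (mem_coordDegreeLT b).1 a.2 i⟩
      invFun := fun f => ⟨b.equivFun.symm fun i => (f i : k[X]), (mem_coordDegreeLT b).2 fun i => by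
        rw [← b.equivFun_apply, LinearEquiv.apply_symm_apply]
        exact (f i).2⟩
      left_inv := fun a => Subtype.ext (b.equivFun.symm_apply_apply (a : A))
      right_inv := fun f => by
        ext i : 2
        exact congrFun (b.equivFun.apply_symm_apply fun i => (f i : k[X])) i
      map_add' := fun x y => by
        ext i : 2
        simp
      map_smul' := fun c x => by
        ext i : 2
        change b.repr (c • (x : A)) i = c • b.repr x i
        rw [← algebraMap_smul k[X] c (x : A), map_smul, Finsupp.smul_apply, algebraMap_smul] :
      coordDegreeLT b n ≃ₗ[k] (ι → degreeLT k n) }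
    (LinearEquiv.piCongrRight fun _ => degreeLTEquiv k n)

theorem finrank_coordDegreeLT {ι : Type*} [Fintype ι] (b : Module.Basis ι k[X] A) (n : ℕ) :
    Module.finrank k (coordDegreeLT b n) = Fintype.card ι * n := by
  rw [(coordDegreeLTEquiv b n).finrank_eq, Module.finrank_pi_fintype]
  simp

/-- A finite torsion-free `k[X]`-algebra has a linear filtration which is respected, up to a uniform
shift, by all semilinear endomorphisms mapping a given spanning set into a given finite set. -/
theorem exists_linearFiltration [IsDomain A] [Module.Finite k[X] A] [Module.IsTorsionFree k[X] A]
    (Y₀ Y : Finset A) (hY₀ : Submodule.span k[X] (Y₀ : Set A) = ⊤) :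
    ∃ (Φ : LinearFiltration k A) (e' : ℕ), ∀ (σ : k →+* k) (ρ : A →+* A),
      (∀ (f : k[X]) (a : A), ρ (f • a) = f.map σ • ρ a) → (∀ y ∈ Y₀, ρ y ∈ Y) →
        ∀ m, ∀ a ∈ Φ.V m, ρ a ∈ Φ.V (m + e') := by
  classical
  obtain ⟨N, b⟩ := Module.basisOfFiniteTypeTorsionFree' (R := k[X]) (M := A)
  obtain ⟨e, he⟩ : ∃ e, ∀ i j l, (b.repr (b i * b j) l).natDegree ≤ e := by
    obtain ⟨e, he⟩ := (Set.finite_range fun x : Fin N × Fin N × Fin N =>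
      (b.repr (b x.1 * b x.2.1) x.2.2).natDegree).bddAbove
    exact ⟨e, fun i j l => he ⟨(i, j, l), rfl⟩⟩
  have hexp : ∀ a, a = ∑ i, b.repr a i • b i := fun a => (b.sum_repr a).symm
  let Φ : LinearFiltration k A :=
    { V := fun m => coordDegreeLT b (m + 1 - e)
      N := N
      c := N * (e + 1)
      N_pos := by
        rcases Nat.eq_zero_or_pos N with rfl | h
        · exfalso
          exact one_ne_zero ((hexp 1).trans (by simp))
        · exact h
      finite := fun m => Module.Finite.equiv (coordDegreeLTEquiv b _).symm
      mul_mem := fun {m n x y} hx hy => by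
        rw [mem_coordDegreeLT] at hx hy ⊢
        intro l
        have hxy : x * y = ∑ i, ∑ j, (b.repr x i * b.repr y j) • (b i * b j) := by
          conv_lhs => rw [hexp x, hexp y, Finset.sum_mul_sum]
          simp_rw [smul_mul_smul_comm]
        rw [hxy]
        simp only [map_sum, map_smul, Finsupp.coe_finsetSum, Finset.sum_apply, Finsupp.smul_apply,
          smul_eq_mul]
        exact sum_mem fun i _ => sum_mem fun j _ =>
          mul_mul_mem_degreeLT (hx i) (hy j) (he i j l)
      exhaust := fun a => by
        refine ⟨e + Finset.univ.sup fun i => (b.repr a i).natDegree, fun m hm => ?_⟩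
        rw [mem_coordDegreeLT]
        intro i
        rw [mem_degreeLT_iff_natDegree]
        right
        have := Finset.le_sup (f := fun i => (b.repr a i).natDegree) (Finset.mem_univ i)
        lia
      le_finrank := fun m => by
        rw [finrank_coordDegreeLT, Fintype.card_fin, ← mul_add]
        exact Nat.mul_le_mul_left _ (by lia)
      finrank_le := fun m => by
        rw [finrank_coordDegreeLT, Fintype.card_fin, ← mul_add]
        exact Nat.mul_le_mul_left _ (by lia) }
  have hbY : ∀ i, ∃ c : A → k[X], ∑ y ∈ Y₀, c y • y = b i := by
    intro i
    have : b i ∈ Submodule.span k[X] (Y₀ : Set A) := hY₀ ▸ Submodule.mem_top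
    rw [Submodule.mem_span_finset] at this
    obtain ⟨c, -, hc⟩ := this
    exact ⟨c, hc⟩
  choose c hc using hbY
  set d₁ := Finset.univ.sup fun i => Y₀.sup fun y => (c i y).natDegree with hd₁
  set d₂ := Y.sup fun y => Finset.univ.sup fun l => (b.repr y l).natDegree with hd₂
  refine ⟨Φ, d₁ + d₂, fun σ ρ hρ hY m a ha => ?_⟩
  change a ∈ coordDegreeLT b _ at ha
  change ρ a ∈ coordDegreeLT b _
  rw [mem_coordDegreeLT] at ha ⊢
  intro l
  have hρa : ρ a = ∑ i, ∑ y ∈ Y₀, ((b.repr a i).map σ * (c i y).map σ) • ρ y := by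
    conv_lhs => rw [hexp a, map_sum]
    refine Finset.sum_congr rfl fun i _ => ?_
    rw [hρ, ← hc, map_sum, Finset.smul_sum]
    refine Finset.sum_congr rfl fun y _ => ?_
    rw [hρ, mul_smul]
  rw [hρa]
  simp only [map_sum, map_smul, Finsupp.coe_finsetSum, Finset.sum_apply, Finsupp.smul_apply,
    smul_eq_mul]
  refine sum_mem fun i _ => sum_mem fun y hy => ?_
  rw [mul_assoc]
  refine mul_mem_degreeLT_add ?_ (natDegree_mul_le.trans (add_le_add ?_ ?_))
  · have := ha i
    rw [mem_degreeLT] at this ⊢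
    exact degree_map_le.trans_lt this
  · refine natDegree_map_le.trans ?_
    exact (Finset.le_sup (f := fun y => (c i y).natDegree) hy).trans
      (Finset.le_sup (f := fun i => Y₀.sup fun y => (c i y).natDegree) (Finset.mem_univ i))
  · exact (Finset.le_sup (f := fun l => (b.repr (ρ y) l).natDegree) (Finset.mem_univ l)).trans
      (Finset.le_sup (f := fun y => Finset.univ.sup fun l => (b.repr y l).natDegree) (hY y hy))

end BasisFiltration

section Points

variable {k A : Type*} [Field k] [IsAlgClosed k] [CommRing A] [IsDomain A] [Algebra k A]
  [Algebra k[X] A] [IsScalarTower k k[X] A] [Module.Finite k[X] A] [Module.IsTorsionFree k[X] A]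

/-- Every point of the affine line lifts to a finite cover. -/
theorem exists_algHom_over (t₀ : k) :
    ∃ ψ : A →ₐ[k] k, ∀ f : k[X], ψ (algebraMap k[X] A f) = f.eval t₀ := by
  have hker : (RingHom.ker (evalRingHom t₀)).IsMaximal :=
    RingHom.ker_isMaximal_of_surjective _ fun c => ⟨C c, by simp⟩
  have hinj : Function.Injective (algebraMap k[X] A) := FaithfulSMul.algebraMap_injective _ _
  obtain ⟨M, hM, hMc⟩ := Ideal.exists_ideal_over_maximal_of_isIntegral (S := A)
    (RingHom.ker (evalRingHom t₀)) (by rw [(RingHom.injective_iff_ker_eq_bot _).1 hinj]; exact bot_le)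
  have hroot : ∀ f : k[X], algebraMap k[X] A f - algebraMap k A (f.eval t₀) ∈ M := by
    intro f
    rw [IsScalarTower.algebraMap_apply k k[X] A, ← map_sub, ← Ideal.mem_comap, hMc,
      RingHom.mem_ker]
    simp
  have hint : Algebra.IsIntegral k (A ⧸ M) := by
    refine ⟨fun x => ?_⟩
    obtain ⟨a, rfl⟩ := Ideal.Quotient.mk_surjective x
    obtain ⟨P, hPm, hP⟩ := Algebra.IsIntegral.isIntegral (R := k[X]) a
    refine ⟨P.map (evalRingHom t₀), hPm.map _, ?_⟩
    have hcomp : (algebraMap k (A ⧸ M)).comp (evalRingHom t₀) =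
        (Ideal.Quotient.mk M).comp (algebraMap k[X] A) := by
      refine RingHom.ext fun f => ?_
      exact (Ideal.Quotient.eq.2 (hroot f)).symm
    rw [eval₂_map, hcomp, ← hom_eval₂, hP, map_zero]
  have hbij := IsAlgClosed.algebraMap_bijective_of_isIntegral (k := k) (K := A ⧸ M)
  let e := AlgEquiv.ofBijective (Algebra.ofId k (A ⧸ M)) hbij
  refine ⟨(e.symm : (A ⧸ M) →ₐ[k] k).comp (Ideal.Quotient.mkₐ k M), fun f => ?_⟩
  have : Ideal.Quotient.mk M (algebraMap k[X] A f) = e (f.eval t₀) :=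
    Ideal.Quotient.eq.2 (hroot f)
  simp [this]

omit [IsAlgClosed k] [IsDomain A] [Module.Finite k[X] A] [Module.IsTorsionFree k[X] A] in
theorem AlgHom.apply_algebraMap_polynomial (ψ : A →ₐ[k] k) (f : k[X]) :
    ψ (algebraMap k[X] A f) = f.eval (ψ (algebraMap k[X] A X)) := by
  have : (ψ.toRingHom.comp (algebraMap k[X] A)) =
      evalRingHom (ψ (algebraMap k[X] A X)) := by
    ext c
    · have : algebraMap k[X] A (C c) = algebraMap k A c :=
        (IsScalarTower.algebraMap_apply k k[X] A c).symm
      simp [this]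
    · simp
  exact RingHom.congr_fun this f

theorem exists_polynomial_vanishing {a : A} (ha : a ≠ 0) :
    ∃ g : k[X], g ≠ 0 ∧ ∀ ψ : A →ₐ[k] k, ψ a = 0 → g.eval (ψ (algebraMap k[X] A X)) = 0 := by
  have := Ideal.comap_ne_bot_of_integral_mem (R := k[X]) ha (Ideal.mem_span_singleton_self a)
    (Algebra.IsIntegral.isIntegral a)
  obtain ⟨g, hg, hg0⟩ := Submodule.exists_mem_ne_zero_of_ne_bot this
  refine ⟨g, hg0, fun ψ hψ => ?_⟩
  obtain ⟨b, hb⟩ := Ideal.mem_span_singleton'.1 (Ideal.mem_comap.1 hg)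
  rw [← AlgHom.apply_algebraMap_polynomial, ← hb, map_mul, hψ, mul_zero]

theorem exists_algHom_apply_ne_zero {a : A} (ha : a ≠ 0) : ∃ ψ : A →ₐ[k] k, ψ a ≠ 0 := by
  obtain ⟨g, hg0, hg⟩ := exists_polynomial_vanishing (k := k) ha
  obtain ⟨t₀, ht₀⟩ : ∃ t₀, g.eval t₀ ≠ 0 := by
    by_contra! hcon
    exact hg0 (Polynomial.funext fun x => by simp [hcon x])
  obtain ⟨ψ, hψ⟩ := exists_algHom_over (A := A) t₀
  exact ⟨ψ, fun h => ht₀ (by simpa [hψ] using hg ψ h)⟩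

theorem AlgHom.ker_ne_bot_of_finite (ψ : A →ₐ[k] k) : RingHom.ker ψ ≠ ⊥ := by
  intro h
  have hinj : Function.Injective (algebraMap k[X] A) := FaithfulSMul.algebraMap_injective _ _
  have hmem : algebraMap k[X] A (X - C (ψ (algebraMap k[X] A X))) ∈ RingHom.ker ψ := by
    rw [RingHom.mem_ker, AlgHom.apply_algebraMap_polynomial]
    simp
  rw [h, Ideal.mem_bot, map_eq_zero_iff _ hinj] at hmem
  exact X_sub_C_ne_zero _ hmem

/-- On a finite cover of the affine line, the number of points at which a power `Q` of Frobenius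
agrees with a given semilinear endomorphism is at most `(1 + ε) Q` once `Q` is large. -/
theorem exists_ncard_frobenius_points_le (p : ℕ) [Fact p.Prime] [CharP k p]
    (Y₀ Y : Finset A) (hY₀ : Submodule.span k[X] (Y₀ : Set A) = ⊤) {ε : ℝ} (hε : 0 < ε) :
    ∃ i₀ : ℕ, ∀ i ≥ i₀, ∀ (σ : k →+* k) (ρ : A →+* A),
      (∀ (f : k[X]) (a : A), ρ (f • a) = f.map σ • ρ a) → (∀ y ∈ Y₀, ρ y ∈ Y) →
        {ψ : A →ₐ[k] k | ∀ a, ψ a ^ p ^ i = ψ (ρ a)}.Finite ∧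
        ({ψ : A →ₐ[k] k | ∀ a, ψ a ^ p ^ i = ψ (ρ a)}.ncard : ℝ) ≤ (1 + ε) * (p : ℝ) ^ i := by
  have : CharP A p := charP_of_injective_algebraMap (algebraMap k A).injective p
  have : IsNoetherianRing A := IsNoetherianRing.of_finite k[X] A
  have hp : 1 < p := (Fact.out : p.Prime).one_lt
  have hp' : (1 : ℝ) < p := by exact_mod_cast hp
  obtain ⟨Φ, e, hΦ⟩ := exists_linearFiltration (k := k) Y₀ Y hY₀
  obtain ⟨μ, hμ⟩ := pow_unbounded_of_one_lt ((Φ.c + Φ.N + 1 : ℝ) * 2 / ε) hp'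
  obtain ⟨C, i₀, h⟩ := Φ.exists_card_frobenius_points_mul_le p
    (fun a ha => exists_algHom_apply_ne_zero ha) (fun ψ => ψ.ker_ne_bot_of_finite) e μ
  obtain ⟨i₁, hi₁⟩ := pow_unbounded_of_one_lt ((C : ℝ) * 2 / ε) hp'
  have hw : (0 : ℝ) < (p : ℝ) ^ μ := by positivity
  have hw1 : (1 : ℝ) ≤ (p : ℝ) ^ μ := one_le_pow₀ hp'.le
  refine ⟨max i₀ i₁, fun i hi σ ρ hρ hY => ?_⟩
  have hQ : (C : ℝ) ≤ ε / 2 * (p : ℝ) ^ i := by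
    have h1 : (p : ℝ) ^ i₁ ≤ (p : ℝ) ^ i := pow_le_pow_right₀ hp'.le ((le_max_right _ _).trans hi)
    have := hi₁.le.trans h1
    rw [div_le_iff₀ hε] at this
    linarith
  have hcard : ∀ S : Finset (A →ₐ[k] k), (↑S ⊆ {ψ : A →ₐ[k] k | ∀ a, ψ a ^ p ^ i = ψ (ρ a)}) →
      (S.card : ℝ) ≤ (1 + ε) * (p : ℝ) ^ i := by
    intro S hS
    have h1 := h i ((le_max_left _ _).trans hi) ρ (hΦ σ ρ hρ hY) S (fun ψ hψ => hS hψ)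
    have h2 : (S.card : ℝ) * (p : ℝ) ^ μ ≤
        ((p : ℝ) ^ μ + (Φ.c + Φ.N + 1)) * (p : ℝ) ^ i + C := by exact_mod_cast h1
    have h3 : (Φ.c + Φ.N + 1 : ℝ) ≤ ε / 2 * (p : ℝ) ^ μ := by
      rw [div_lt_iff₀ hε] at hμ
      linarith
    have h4 : (0 : ℝ) < (p : ℝ) ^ i := by positivity
    refine le_of_mul_le_mul_right ?_ hw
    calc (S.card : ℝ) * (p : ℝ) ^ μ ≤ ((p : ℝ) ^ μ + (Φ.c + Φ.N + 1)) * (p : ℝ) ^ i + C := h2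
      _ ≤ ((p : ℝ) ^ μ + ε / 2 * (p : ℝ) ^ μ) * (p : ℝ) ^ i +
          ε / 2 * (p : ℝ) ^ i * (p : ℝ) ^ μ := by
        gcongr
        exact hQ.trans (le_mul_of_one_le_right (by positivity) hw1)
      _ = (1 + ε) * (p : ℝ) ^ i * (p : ℝ) ^ μ := by ring
  have hfin : {ψ : A →ₐ[k] k | ∀ a, ψ a ^ p ^ i = ψ (ρ a)}.Finite := by
    by_contra hinf
    obtain ⟨n, hn⟩ := exists_nat_gt ((1 + ε) * (p : ℝ) ^ i)
    obtain ⟨S, hS, hSn⟩ := Set.Infinite.exists_subset_card_eq hinf n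
    have := hcard S hS
    rw [hSn] at this
    linarith
  refine ⟨hfin, ?_⟩
  rw [Set.ncard_eq_toFinset_card _ hfin]
  exact hcard _ (by simp)

end Points

section Transitivity

/-- A root of the reduction of a split monic polynomial lifts to a root of the polynomial. -/
theorem Polynomial.Monic.exists_root_lift {R A K Ω : Type*} [CommRing R] [CommRing A] [Field K]
    [CommRing Ω] [IsDomain Ω] [Algebra R A] [Algebra A K] [Algebra R K] [IsScalarTower R A K]
    [FaithfulSMul A K] {P : R[X]} (hP : P.Monic) (hs : (P.map (algebraMap R K)).Splits)
    (hr : ∀ x ∈ (P.map (algebraMap R K)).roots, ∃ a, algebraMap A K a = x) (ψ : A →+* Ω) {x : Ω}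
    (hx : P.eval₂ (ψ.comp (algebraMap R A)) x = 0) :
    ∃ s : A, aeval s P = 0 ∧ ψ s = x := by
  have hinj : Function.Injective (algebraMap A K) := FaithfulSMul.algebraMap_injective _ _
  obtain ⟨m, hm⟩ : ∃ m : Multiset A, m.map (algebraMap A K) = (P.map (algebraMap R K)).roots := by
    have : CanLift K A (algebraMap A K) (fun x => ∃ a, algebraMap A K a = x) := ⟨fun _ h => h⟩
    exact (Multiset.canLift (algebraMap A K) fun x => ∃ a, algebraMap A K a = x).prf _ hr
  have hprod : P.map (algebraMap R A) = (m.map fun a => X - C a).prod := by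
    apply Polynomial.map_injective _ hinj
    rw [Polynomial.map_map, ← IsScalarTower.algebraMap_eq, Polynomial.map_multiset_prod,
      Multiset.map_map, hs.eq_prod_roots_of_monic (hP.map _), ← hm, Multiset.map_map]
    simp
  rw [← eval₂_map, hprod, eval₂_multiset_prod, Multiset.map_map, Multiset.prod_eq_zero_iff,
    Multiset.mem_map] at hx
  obtain ⟨s, hs, h0⟩ := hx
  refine ⟨s, ?_, ?_⟩
  · rw [aeval_def, ← eval_map, hprod, eval_multiset_prod, Multiset.map_map]
    exact Multiset.prod_eq_zero (Multiset.mem_map.2 ⟨s, hs, by simp⟩)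
  · simpa [sub_eq_zero, eq_comm (a := x)] using h0

variable {k E K : Type*} [Field k] [Infinite k] [Field E] [Field K] [Algebra k[X] E]
  [IsFractionRing k[X] E] [Algebra E K] [Algebra k[X] K] [IsScalarTower k[X] E K]
  [FiniteDimensional E K] [Normal E K] [Algebra k K] [IsScalarTower k k[X] K]

/-- The Galois group acts transitively on the points of a normal cover over a given point. -/
theorem exists_galois_conj (A : Subalgebra k[X] K) [Algebra.IsIntegral k[X] A]
    (hA : ∀ g : K ≃ₐ[E] K, ∀ a ∈ A, g a ∈ A)
    {Ω : Type*} [Field Ω] (ψ₁ ψ₂ : A →+* Ω)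
    (hψ : ψ₁.comp (algebraMap k[X] A) = ψ₂.comp (algebraMap k[X] A)) :
    ∃ g : K ≃ₐ[E] K, ∀ a : A, ψ₁ a = ψ₂ ⟨g a, hA g a a.2⟩ := by
  let W : (K ≃ₐ[E] K) → Submodule k A := fun g =>
    { carrier := {a | ψ₁ a = ψ₂ ⟨g a, hA g a a.2⟩}
      zero_mem' := by
        have : (⟨g (0 : A), hA g _ (0 : A).2⟩ : A) = 0 := Subtype.ext (by simp)
        simp only [Set.mem_ofPred_eq, this, map_zero]
      add_mem' := by
        intro a b ha hb
        have : (⟨g (a + b : A), hA g _ (a + b).2⟩ : A) =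
            ⟨g a, hA g a a.2⟩ + ⟨g b, hA g b b.2⟩ := Subtype.ext (by simp)
        simp only [Set.mem_ofPred_eq] at ha hb ⊢
        rw [this, map_add, map_add, ha, hb]
      smul_mem' := by
        intro c a ha
        have hc : ∀ b : A, c • b = algebraMap k[X] A (C c) * b := fun b => by
          rw [← Algebra.smul_def]
          exact (algebraMap_smul k[X] c b).symm
        have hgc : g (algebraMap k[X] K (C c)) = algebraMap k[X] K (C c) := by
          rw [IsScalarTower.algebraMap_apply k[X] E K, AlgEquiv.commutes]
        have : (⟨g (c • a : A), hA g _ (c • a).2⟩ : A) =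
            algebraMap k[X] A (C c) * ⟨g a, hA g a a.2⟩ := Subtype.ext (by
          simp only [hc, MulMemClass.coe_mul, map_mul]
          congr 1)
        simp only [Set.mem_ofPred_eq] at ha ⊢
        rw [this, hc, map_mul, map_mul, ha]
        congr 1
        exact RingHom.congr_fun hψ (C c) }
  have hcov : ⋃ g, (W g : Set A) = Set.univ := by
    refine Set.eq_univ_of_forall fun a => Set.mem_iUnion.2 ?_
    have hai : IsIntegral k[X] (a : K) := (Algebra.IsIntegral.isIntegral (R := k[X]) a).map A.val
    have hmin : minpoly E (a : K) = (minpoly k[X] (a : K)).map (algebraMap k[X] E) :=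
      minpoly.isIntegrallyClosed_eq_field_fractions' E hai
    have hmap : (minpoly k[X] (a : K)).map (algebraMap k[X] K) =
        (minpoly E (a : K)).map (algebraMap E K) := by
      rw [hmin, Polynomial.map_map, ← IsScalarTower.algebraMap_eq]
    have hconj : ∀ x : K, aeval x (minpoly E (a : K)) = 0 → ∃ g : K ≃ₐ[E] K, g a = x := by
      intro x hx
      have : minpoly E x = minpoly E (a : K) := (minpoly.eq_of_irreducible_of_monic
        (minpoly.irreducible hai.tower_top) hx (minpoly.monic hai.tower_top)).symm
      exact (Normal.minpoly_eq_iff_mem_orbit K).1 this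
    obtain ⟨s, hs, hsx⟩ := (minpoly.monic hai).exists_root_lift (K := K) (A := A) (x := ψ₁ a)
      (by rw [hmap]; exact Normal.splits ‹_› _)
      (fun x hx => by
        obtain ⟨g, rfl⟩ := hconj x (by
          rw [hmap] at hx
          rw [aeval_def, ← eval_map]
          exact (mem_roots'.1 hx).2)
        exact ⟨⟨g a, hA g a a.2⟩, rfl⟩) ψ₂
      (by
        rw [← hψ, ← hom_eval₂, ← aeval_def]
        have : aeval a (minpoly k[X] (a : K)) = 0 := by
          apply Subtype.val_injective
          have := minpoly.aeval k[X] (a : K)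
          rwa [Subalgebra.aeval_coe] at this
        rw [this, map_zero])
    obtain ⟨g, hg⟩ := hconj (s : K) (by
      rw [hmin, aeval_map_algebraMap, Subalgebra.aeval_coe, hs, ZeroMemClass.coe_zero])
    refine ⟨g, ?_⟩
    change ψ₁ a = ψ₂ ⟨g a, hA g a a.2⟩
    rw [← hsx]
    congr 1
    exact Subtype.ext hg.symm
  obtain ⟨g, hg⟩ := Subspace.exists_eq_top_of_iUnion_eq_univ hcov
  refine ⟨g, fun a => ?_⟩
  have : a ∈ W g := hg ▸ Submodule.mem_top
  exact this

end Transitivity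

section Specialization

variable {k E K : Type*} [Field k] [IsAlgClosed k] [Field E] [Field K] [Algebra k[X] E]
  [IsFractionRing k[X] E] [Algebra E K] [Algebra k[X] K] [IsScalarTower k[X] E K]
  [FiniteDimensional E K] [Normal E K] [Algebra k K] [IsScalarTower k k[X] K]

omit [IsAlgClosed k] [Algebra k K] [IsScalarTower k k[X] K] in
/-- A semilinear endomorphism permuting `S` preserves the algebra generated by `S`. -/
theorem RingHom.apply_mem_adjoin {S : Set K} (θ : K →+* K) (σ : k →+* k)
    (hθ : ∀ f : k[X], θ (algebraMap k[X] K f) = algebraMap k[X] K (f.map σ))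
    (hS : ∀ s ∈ S, θ s ∈ S) : ∀ a ∈ Algebra.adjoin k[X] S, θ a ∈ Algebra.adjoin k[X] S := by
  intro a ha
  induction ha using Algebra.adjoin_induction with
  | mem x hx => exact Algebra.subset_adjoin (hS x hx)
  | algebraMap r => rw [hθ]; exact Subalgebra.algebraMap_mem _ _
  | add x y _ _ hx hy => rw [map_add]; exact add_mem hx hy
  | mul x y _ _ hx hy => rw [map_mul]; exact mul_mem hx hy

/-- Chebotarev-type upper bound: among the rational points `t₀` of the affine line, the proportion
at which the specialization of `h` has a rational root is asymptotically at most the proportion of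
Galois elements fixing a root of `h`, as soon as Frobenius lifts to an endomorphism fixing all
roots of `h`. -/
theorem exists_ncard_specializations_le (p : ℕ) [Fact p.Prime] [CharP k p] (h : k[X][X])
    (hm : h.Monic) (hs : (h.map (algebraMap k[X] K)).Splits)
    (hgen : ∀ g : K ≃ₐ[E] K, (∀ s ∈ h.rootSet K, g s = s) → g = 1) {ε : ℝ} (hε : 0 < ε) :
    ∃ C i₀ : ℕ, ∀ i ≥ i₀, ∀ τ : K →+* K,
      (∀ f : k[X], τ (algebraMap k[X] K f) =
        algebraMap k[X] K (f.map (iterateFrobenius k p i))) →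
      (∀ s ∈ h.rootSet K, τ s = s) →
      (Nat.card (K ≃ₐ[E] K) : ℝ) * ({t₀ : k | t₀ ^ p ^ i = t₀ ∧
        ∃ x₀, x₀ ^ p ^ i = x₀ ∧ h.eval₂ (evalRingHom t₀) x₀ = 0}.ncard : ℝ) ≤
      Nat.card {g : K ≃ₐ[E] K // ∃ s ∈ h.rootSet K, g s = s} * ((1 + ε) * (p : ℝ) ^ i) + C := by
  classical
  set S := h.rootSet K with hS
  have hSfin : S.Finite := rootSet_finite _ _
  have hmem : ∀ x : K, x ∈ S ↔ aeval x h = 0 := fun x =>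
    mem_rootSet'.trans ⟨And.right, fun hx => ⟨(hm.map _).ne_zero, hx⟩⟩
  set A := Algebra.adjoin k[X] S with hA
  have hAfin : Module.Finite k[X] A := Module.Finite.iff_fg.2
    (fg_adjoin_of_finite hSfin fun x hx => ⟨h, hm, (hmem x).1 hx⟩)
  have : FaithfulSMul k[X] K := by
    have h1 := FaithfulSMul.algebraMap_injective k[X] E
    rw [faithfulSMul_iff_algebraMap_injective, IsScalarTower.algebraMap_eq k[X] E K]
    exact (algebraMap E K).injective.comp h1
  have : Module.IsTorsionFree k[X] A := inferInstance
  have hgX : ∀ (g : K ≃ₐ[E] K) (f : k[X]), g (algebraMap k[X] K f) = algebraMap k[X] K f := by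
    intro g f
    rw [IsScalarTower.algebraMap_apply k[X] E K, AlgEquiv.commutes]
  have hgS : ∀ (g : K ≃ₐ[E] K), ∀ s ∈ S, g s ∈ S := by
    intro g s hs
    rw [hmem] at hs ⊢
    have : aeval ((g.toAlgHom.restrictScalars k[X]) s) h = 0 := by
      rw [aeval_algHom_apply, hs, map_zero]
    exact this
  have hgA : ∀ g : K ≃ₐ[E] K, ∀ a ∈ A, g a ∈ A := fun g =>
    RingHom.apply_mem_adjoin (g : K →+* K) (RingHom.id k) (fun f => by simpa using hgX g f)
      (hgS g)
  let γ : (K ≃ₐ[E] K) → A →+* A := fun g => (g : K →+* K).restrict A A (hgA g)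
  have hγ : ∀ g (a : A), (γ g a : K) = g a := fun _ _ => rfl
  have hγR : ∀ g (f : k[X]), γ g (algebraMap k[X] A f) = algebraMap k[X] A f := fun g f =>
    Subtype.ext (hgX g f)
  -- A finite spanning set consisting of monomials in the roots.
  let S' : Set A := Subtype.val ⁻¹' S
  obtain ⟨Y₀, hY₀S, hY₀⟩ : ∃ Y₀ : Finset A, ↑Y₀ ⊆ (Submonoid.closure S' : Set A) ∧
      Submodule.span k[X] (Y₀ : Set A) = ⊤ := by
    have h1 : Submodule.span k[X] (Submonoid.closure S' : Set A) = ⊤ := by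
      rw [← Algebra.adjoin_eq_span, Algebra.adjoin_adjoin_coe_preimage, Algebra.top_toSubmodule]
    obtain ⟨Y₀, hY₀, h2⟩ := (Submodule.fg_span_iff_fg_span_finset_subset _).1
      (h1 ▸ Module.Finite.fg_top)
    exact ⟨Y₀, hY₀, h2 ▸ h1⟩
  let Y : Finset A := Finset.univ.biUnion fun g => Y₀.image (γ g)
  -- The product of the differences of distinct roots.
  have hS'fin : S'.Finite := hSfin.preimage Subtype.val_injective.injOn
  let δ : A := ∏ s ∈ hS'fin.toFinset, ∏ s' ∈ hS'fin.toFinset.erase s, (s - s')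
  have hδ : δ ≠ 0 := by
    refine Finset.prod_ne_zero_iff.2 fun s _ => Finset.prod_ne_zero_iff.2 fun s' hs' => ?_
    exact sub_ne_zero.2 (Finset.ne_of_mem_erase hs').symm
  have hψinj : ∀ ψ : A →ₐ[k] k, ψ δ ≠ 0 → Set.InjOn ψ S' := by
    intro ψ hψ s hs s' hs' heq
    by_contra hne
    refine hψ ?_
    rw [map_prod]
    refine Finset.prod_eq_zero (hS'fin.mem_toFinset.2 hs) ?_
    rw [map_prod]
    refine Finset.prod_eq_zero (Finset.mem_erase.2 ⟨Ne.symm hne, hS'fin.mem_toFinset.2 hs'⟩) ?_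
    rw [map_sub, heq, sub_self]
  obtain ⟨b, hb0, hb⟩ := exists_polynomial_vanishing (k := k) hδ
  obtain ⟨i₀, hi₀⟩ := exists_ncard_frobenius_points_le (k := k) p Y₀ Y hY₀ hε
  refine ⟨Nat.card (K ≃ₐ[E] K) * b.natDegree, max i₀ 1, fun i hi τ hτ hτS => ?_⟩
  set Q := p ^ i with hQ
  have hQ0 : Q ≠ 0 := pow_ne_zero _ (Fact.out : p.Prime).ne_zero
  have hτA : ∀ a ∈ A, τ a ∈ A := RingHom.apply_mem_adjoin τ (iterateFrobenius k p i) hτ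
    fun s hs => by rw [hτS s hs]; exact hs
  let ρ : A →+* A := τ.restrict A A hτA
  have hρS : Set.EqOn ρ (RingHom.id A) (Submonoid.closure S') :=
    MonoidHom.eqOn_closureM (f := (ρ : A →* A)) (g := (RingHom.id A : A →* A))
      fun s hs => Subtype.ext (hτS s hs)
  have hρR : ∀ f : k[X], ρ (algebraMap k[X] A f) =
      algebraMap k[X] A (f.map (iterateFrobenius k p i)) := fun f => Subtype.ext (hτ f)
  have hγcl : ∀ g, ∀ y ∈ Submonoid.closure S', γ g y ∈ Submonoid.closure S' := by
    intro g y hy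
    have : Submonoid.closure S' ≤ (Submonoid.closure S').comap (γ g : A →* A) :=
      Submonoid.closure_le.2 fun s hs => Submonoid.subset_closure (hgS g s hs)
    exact this hy
  let P : (K ≃ₐ[E] K) → Set (A →ₐ[k] k) := fun g => {ψ | ∀ a, ψ a ^ Q = ψ ((ρ.comp (γ g)) a)}
  have hP : ∀ g, (P g).Finite ∧ ((P g).ncard : ℝ) ≤ (1 + ε) * (p : ℝ) ^ i := fun g =>
    hi₀ i ((le_max_left _ _).trans hi) (iterateFrobenius k p i) (ρ.comp (γ g))
      (fun f a => by
        rw [Algebra.smul_def, Algebra.smul_def, map_mul, RingHom.comp_apply, hγR, hρR])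
      (fun y hy => by
        rw [RingHom.comp_apply, hρS (hγcl g y (hY₀S hy))]
        exact Finset.mem_biUnion.2 ⟨g, Finset.mem_univ _, Finset.mem_image_of_mem _ hy⟩)
  let D : Finset (K ≃ₐ[E] K) := Finset.univ.filter fun g => ∃ s ∈ S, g s = s
  have hD : Nat.card {g : K ≃ₐ[E] K // ∃ s ∈ S, g s = s} = D.card := by
    rw [Nat.card_eq_fintype_card, Fintype.card_subtype]
  set T : Set k := {t₀ : k | t₀ ^ Q = t₀ ∧
    ∃ x₀, x₀ ^ Q = x₀ ∧ h.eval₂ (evalRingHom t₀) x₀ = 0} with hT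
  have hX0 : (X ^ Q - X : k[X]) ≠ 0 :=
    FiniteField.X_pow_card_pow_sub_X_ne_zero k (Nat.one_le_iff_ne_zero.1
      ((le_max_right _ _).trans hi)) (Fact.out : p.Prime).one_lt
  have hTfin : T.Finite := by
    refine (rootSet_finite (X ^ Q - X : k[X]) k).subset fun t ht => ?_
    rw [mem_rootSet']
    refine ⟨by simpa using hX0, ?_⟩
    simp [ht.1]
  let T' : Finset k := hTfin.toFinset.filter fun t => b.eval t ≠ 0
  have hTcard : T.ncard ≤ T'.card + b.natDegree := by
    have h1 : T ⊆ T' ∪ b.roots.toFinset := by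
      intro t ht
      by_cases hbt : b.eval t = 0
      · exact Or.inr (by simp [hb0, hbt])
      · exact Or.inl (by simp [T', ht, hbt])
    refine (Set.ncard_le_ncard h1 (Finset.finite_toSet _ |>.union (Finset.finite_toSet _))).trans ?_
    rw [← Finset.coe_union, Set.ncard_coe_finset]
    refine (Finset.card_union_le _ _).trans (Nat.add_le_add_left ?_ _)
    exact (Multiset.toFinset_card_le _).trans (card_roots' b)
  choose ψ₀ hψ₀ using fun t₀ : k => exists_algHom_over (A := A) t₀
  have hγk : ∀ g (c : k), γ g (algebraMap k A c) = algebraMap k A c := fun g c => by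
    rw [IsScalarTower.algebraMap_apply k k[X] A, hγR]
  let Ψ : k × (K ≃ₐ[E] K) → (A →ₐ[k] k) := fun x =>
    { (ψ₀ x.1 : A →+* k).comp (γ x.2) with
      commutes' := fun c => by
        change ψ₀ x.1 (γ x.2 (algebraMap k A c)) = c
        rw [hγk, AlgHom.commutes]
        rfl }
  have hΨ : ∀ t g a, Ψ (t, g) a = ψ₀ t (γ g a) := fun _ _ _ => rfl
  have hΨR : ∀ t g f, Ψ (t, g) (algebraMap k[X] A f) = f.eval t := fun t g f => by
    rw [hΨ, hγR, hψ₀]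
  let U : Finset (A →ₐ[k] k) := D.biUnion fun g => (hP g).1.toFinset
  have hgood : ∀ t ∈ T', ∀ ψ : A →ₐ[k] k, (∀ f, ψ (algebraMap k[X] A f) = f.eval t) →
      Set.InjOn ψ S' := by
    intro t ht ψ hψ
    refine hψinj ψ fun h0 => (Finset.mem_filter.1 ht).2 ?_
    simpa [hψ] using hb ψ h0
  have hmaps : Set.MapsTo Ψ ↑(T' ×ˢ (Finset.univ : Finset (K ≃ₐ[E] K))) (U : Set (A →ₐ[k] k)) := by
    rintro ⟨t, g⟩ htg
    have ht : t ∈ T' := (Finset.mem_product.1 htg).1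
    obtain ⟨htQ, x₀, hxQ, hx₀⟩ := hTfin.mem_toFinset.1 (Finset.mem_filter.1 ht).1
    set ψ := Ψ (t, g) with hψ
    have hψR : ∀ f, ψ (algebraMap k[X] A f) = f.eval t := hΨR t g
    obtain ⟨g', hg'⟩ := exists_galois_conj (E := E) A hgA
      ((iterateFrobenius k p i).comp (ψ : A →+* k)) ((ψ : A →+* k).comp ρ) (by
        refine RingHom.ext fun f => ?_
        change iterateFrobenius k p i (ψ (algebraMap k[X] A f)) = ψ (ρ (algebraMap k[X] A f))
        rw [hρR, hψR, hψR, eval_map, ← eval₂_at_apply, iterateFrobenius_def, ← hQ, htQ])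
    have hg'P : ψ ∈ P g' := fun a => by
      have := hg' a
      simp only [RingHom.comp_apply, iterateFrobenius_def] at this
      exact this
    refine Finset.mem_coe.2 (Finset.mem_biUnion.2 ⟨g', Finset.mem_filter.2 ⟨Finset.mem_univ _, ?_⟩,
      (hP g').1.mem_toFinset.2 hg'P⟩)
    obtain ⟨s, hs0, hsx⟩ := hm.exists_root_lift (K := K) (A := A) (x := x₀) hs
      (fun x hx => ⟨⟨x, Algebra.subset_adjoin ((hmem x).2 (by
        rw [aeval_def, ← eval_map]; exact (mem_roots'.1 hx).2))⟩, rfl⟩) (ψ : A →+* k)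
      (by
        have : (ψ : A →+* k).comp (algebraMap k[X] A) = evalRingHom t := RingHom.ext hψR
        rw [this, hx₀])
    have hsS : s ∈ S' := (hmem _).2 (by
      rw [Subalgebra.aeval_coe, hs0, ZeroMemClass.coe_zero])
    have hgsS : γ g' s ∈ S' := hgS g' _ hsS
    have h1 : ψ s = ψ (γ g' s) := by
      have h2 := hg'P s
      rw [RingHom.comp_apply, hρS (Submonoid.subset_closure hgsS)] at h2
      rw [← RingHom.id_apply (γ g' s), ← h2]
      have : ψ s = x₀ := hsx
      rw [this, hxQ]
    have h2 := hgood t ht ψ hψR hsS hgsS h1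
    exact ⟨s, hsS, (congrArg Subtype.val h2).symm⟩
  have hinj : Set.InjOn Ψ ↑(T' ×ˢ (Finset.univ : Finset (K ≃ₐ[E] K))) := by
    rintro ⟨t, g⟩ htg ⟨t', g'⟩ _ heq
    have ht : t ∈ T' := (Finset.mem_product.1 htg).1
    have h1 := hΨR t g X
    rw [heq, hΨR] at h1
    simp only [eval_X] at h1
    subst h1
    refine Prod.ext rfl ?_
    have h2 : ∀ s ∈ S, g s = g' s := by
      intro s hs
      have h3 := DFunLike.congr_fun heq (⟨s, Algebra.subset_adjoin hs⟩ : A)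
      rw [hΨ, hΨ] at h3
      exact congrArg Subtype.val (hgood t' ht (ψ₀ t') (hψ₀ t') (hgS g s hs) (hgS g' s hs) h3)
    have h3 : g'⁻¹ * g = 1 := hgen _ fun s hs => by
      rw [AlgEquiv.mul_apply, h2 s hs]
      exact g'.symm_apply_apply s
    exact (inv_mul_eq_one.1 h3).symm
  have hcard := Finset.card_le_card_of_injOn Ψ hmaps hinj
  rw [Finset.card_product, Finset.card_univ, ← Nat.card_eq_fintype_card] at hcard
  have hU : (U.card : ℝ) ≤ D.card * ((1 + ε) * (p : ℝ) ^ i) := by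
    calc (U.card : ℝ) ≤ ∑ g ∈ D, ((hP g).1.toFinset.card : ℝ) := by
          exact_mod_cast Finset.card_biUnion_le
      _ ≤ ∑ g ∈ D, (1 + ε) * (p : ℝ) ^ i := Finset.sum_le_sum fun g _ => by
          rw [← Set.ncard_eq_toFinset_card _ (hP g).1]
          exact (hP g).2
      _ = _ := by rw [Finset.sum_const, nsmul_eq_mul]
  rw [hD]
  have h1 : (T.ncard : ℝ) ≤ T'.card + b.natDegree := by exact_mod_cast hTcard
  have h2 : (T'.card : ℝ) * Nat.card (K ≃ₐ[E] K) ≤ U.card := by exact_mod_cast hcard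
  push_cast
  nlinarith [mul_le_mul_of_nonneg_left h1 (Nat.cast_nonneg (α := ℝ) (Nat.card (K ≃ₐ[E] K)))]

end Specialization

section NonMonic

variable {k E K : Type*} [Field k] [IsAlgClosed k] [Field E] [Field K] [Algebra k[X] E]
  [IsFractionRing k[X] E] [Algebra E K] [Algebra k[X] K] [IsScalarTower k[X] E K]
  [FiniteDimensional E K] [Normal E K] [Algebra k K] [IsScalarTower k k[X] K]

/-- The version of `exists_ncard_specializations_le` for polynomials that need not be monic. -/
theorem exists_ncard_specializations_le_of_ne_zero (p : ℕ) [Fact p.Prime] [CharP k p]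
    (f : k[X][X]) (hf : f ≠ 0) (hs : (f.map (algebraMap k[X] K)).Splits)
    (hgen : ∀ g : K ≃ₐ[E] K, (∀ s ∈ f.rootSet K, g s = s) → g = 1) {ε : ℝ} (hε : 0 < ε) :
    ∃ C i₀ : ℕ, ∀ i ≥ i₀, f.leadingCoeff.map (iterateFrobenius k p i) = f.leadingCoeff →
      ∀ τ : K →+* K,
      (∀ f : k[X], τ (algebraMap k[X] K f) =
        algebraMap k[X] K (f.map (iterateFrobenius k p i))) →
      (∀ s ∈ f.rootSet K, τ s = s) →
      (Nat.card (K ≃ₐ[E] K) : ℝ) * ({t₀ : k | t₀ ^ p ^ i = t₀ ∧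
        ∃ x₀, x₀ ^ p ^ i = x₀ ∧ f.eval₂ (evalRingHom t₀) x₀ = 0}.ncard : ℝ) ≤
      Nat.card {g : K ≃ₐ[E] K // ∃ s ∈ f.rootSet K, g s = s} * ((1 + ε) * (p : ℝ) ^ i) + C := by
  have hKinj : Function.Injective (algebraMap k[X] K) := by
    rw [IsScalarTower.algebraMap_eq k[X] E K]
    exact (algebraMap E K).injective.comp (FaithfulSMul.algebraMap_injective k[X] E)
  rcases Nat.eq_zero_or_pos f.natDegree with h0 | h0
  · obtain ⟨c, rfl⟩ := natDegree_eq_zero.1 h0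
    have hc : c ≠ 0 := by rintro rfl; simp at hf
    refine ⟨Nat.card (K ≃ₐ[E] K) * c.natDegree, 0, fun i _ _ τ _ _ => ?_⟩
    have h1 : {t₀ : k | t₀ ^ p ^ i = t₀ ∧
        ∃ x₀, x₀ ^ p ^ i = x₀ ∧ (C c).eval₂ (evalRingHom t₀) x₀ = 0} ⊆ c.rootSet k := by
      rintro t ⟨-, x, -, h⟩
      rw [mem_rootSet']
      exact ⟨by simpa using hc, by simpa [aeval_def] using h⟩
    have h2 := (Set.ncard_le_ncard h1 (rootSet_finite _ _)).trans (ncard_rootSet_le c k)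
    have h3 : (0 : ℝ) ≤ Nat.card {g : K ≃ₐ[E] K // ∃ s ∈ (C c).rootSet K, g s = s} *
        ((1 + ε) * (p : ℝ) ^ i) := by positivity
    refine le_trans ?_ (le_add_of_nonneg_left h3)
    push_cast
    gcongr
  set ℓ := f.leadingCoeff with hℓ
  have hℓ0 : ℓ ≠ 0 := leadingCoeff_ne_zero.2 hf
  have hℓK : algebraMap k[X] K ℓ ≠ 0 := by simpa using (hKinj.ne_iff' (map_zero _)).2 hℓ0
  set h := integralNormalization f with hh
  have hm : h.Monic := monic_integralNormalization hf
  have hmem : ∀ (g : k[X][X]), g ≠ 0 → ∀ x : K, x ∈ g.rootSet K ↔ aeval x g = 0 :=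
    fun g hg x => mem_rootSet'.trans ⟨And.right, fun hx =>
      ⟨(Polynomial.map_ne_zero_iff hKinj).2 hg, hx⟩⟩
  have hev : ∀ x : K, aeval (algebraMap k[X] K ℓ * x) h =
      algebraMap k[X] K ℓ ^ (f.natDegree - 1) * aeval x f := fun x =>
    integralNormalization_eval₂_leadingCoeff_mul h0 (algebraMap k[X] K) x
  have hroot : ∀ x : K, algebraMap k[X] K ℓ * x ∈ h.rootSet K ↔ x ∈ f.rootSet K := by
    intro x
    rw [hmem _ hm.ne_zero, hmem _ hf, hev]
    simp [hℓK]
  have hroot' : ∀ y ∈ h.rootSet K, ∃ x ∈ f.rootSet K, y = algebraMap k[X] K ℓ * x := by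
    intro y hy
    have hy' : y = algebraMap k[X] K ℓ * (y / algebraMap k[X] K ℓ) := by field_simp
    exact ⟨_, (hroot _).1 (hy' ▸ hy), hy'⟩
  have hsplit : (h.map (algebraMap k[X] K)).Splits := by
    have h1 := hs.scaleRoots (algebraMap k[X] K ℓ)
    rw [← leadingCoeff_map_of_leadingCoeff_ne_zero _ hℓK,
      ← leadingCoeff_smul_integralNormalization, integralNormalization_map _ _ hℓK] at h1
    refine h1.of_dvd ?_ ?_
    · rw [leadingCoeff_map_of_leadingCoeff_ne_zero _ hℓK]
      exact smul_ne_zero hℓK (hm.map _).ne_zero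
    · rw [smul_eq_C_mul]
      exact dvd_mul_left _ _
  have hgℓ : ∀ g : K ≃ₐ[E] K, g (algebraMap k[X] K ℓ) = algebraMap k[X] K ℓ := fun g => by
    rw [IsScalarTower.algebraMap_apply k[X] E K, AlgEquiv.commutes]
  have hfix : ∀ (g : K ≃ₐ[E] K) (x : K),
      g (algebraMap k[X] K ℓ * x) = algebraMap k[X] K ℓ * x ↔ g x = x := fun g x => by
    rw [map_mul, hgℓ, mul_right_inj' hℓK]
  obtain ⟨C, i₀, hC⟩ := exists_ncard_specializations_le (E := E) (K := K) p h hm hsplit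
    (fun g hg => hgen g fun s hs => (hfix g s).1 (hg _ ((hroot s).2 hs))) hε
  refine ⟨C, max i₀ 1, fun i hi hℓi τ hτ hτS => ?_⟩
  have hmain := hC i ((le_max_left _ _).trans hi) τ hτ fun y hy => by
    obtain ⟨x, hx, rfl⟩ := hroot' y hy
    rw [map_mul, hτ, hℓi, hτS x hx]
  have hcard : Nat.card {g : K ≃ₐ[E] K // ∃ s ∈ h.rootSet K, g s = s} =
      Nat.card {g : K ≃ₐ[E] K // ∃ s ∈ f.rootSet K, g s = s} := by
    refine Nat.card_congr (Equiv.subtypeEquivRight fun g => ⟨?_, ?_⟩)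
    · rintro ⟨y, hy, hgy⟩
      obtain ⟨x, hx, rfl⟩ := hroot' y hy
      exact ⟨x, hx, (hfix g x).1 hgy⟩
    · rintro ⟨x, hx, hgx⟩
      exact ⟨_, (hroot x).2 hx, (hfix g x).2 hgx⟩
  rw [hcard] at hmain
  refine le_trans ?_ hmain
  have hX0 : (X ^ p ^ i - X : k[X]) ≠ 0 :=
    FiniteField.X_pow_card_pow_sub_X_ne_zero k (Nat.one_le_iff_ne_zero.1
      ((le_max_right _ _).trans hi)) (Fact.out : p.Prime).one_lt
  gcongr ?_ * ?_
  norm_cast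
  refine Set.ncard_le_ncard ?_ ((rootSet_finite (X ^ p ^ i - X : k[X]) k).subset fun t ht => ?_)
  · rintro t ⟨ht, x, hx, hfx⟩
    refine ⟨ht, ℓ.eval t * x, ?_, ?_⟩
    · have : ℓ.eval t ^ p ^ i = ℓ.eval t := by
        conv_rhs => rw [← hℓi, eval_map, ← ht]
        rw [← iterateFrobenius_def, ← iterateFrobenius_def, eval₂_at_apply]
      rw [mul_pow, this, hx]
    · have := integralNormalization_eval₂_leadingCoeff_mul h0 (evalRingHom t) x
      rw [hfx, mul_zero] at this
      exact this
  · rw [mem_rootSet']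
    exact ⟨by simpa using hX0, by simp [ht.1]⟩

end NonMonic

open scoped TensorProduct

section Regular

variable {F L K : Type*} [Field F] [Field L] [Field K] [Algebra F L] [Algebra F K] [Algebra L K]
  [IsScalarTower F L K]

/-- If `F` is algebraically closed in `L`, then minimal polynomials over `F` and `L` agree. -/
theorem minpoly.map_eq_of_forall_isIntegral
    (hL : ∀ x : L, IsIntegral F x → x ∈ Set.range (algebraMap F L)) {c : K} (hc : IsIntegral F c) :
    (minpoly F c).map (algebraMap F L) = minpoly L c := by
  have hcL : IsIntegral L c := hc.tower_top
  have hdvd := minpoly.dvd_map_of_isScalarTower F L c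
  obtain ⟨g, hg⟩ := (mem_lifts _).1 (integralClosure.mem_lifts_of_monic_of_dvd_map L
    (minpoly.monic hc) (minpoly.monic hcL) hdvd)
  obtain ⟨g', hg'⟩ : ∃ g' : F[X], g'.map (algebraMap F L) = minpoly L c := by
    refine (mem_lifts _).1 ((lifts_iff_coeff_lifts _).2 fun n => ?_)
    rw [← hg, coeff_map]
    exact hL _ (g.coeff n).2
  have hm : g'.Monic := by
    refine monic_of_injective (algebraMap F L).injective ?_
    rw [hg']
    exact minpoly.monic hcL
  have h0 : Polynomial.aeval c g' = 0 := by
    rw [← aeval_map_algebraMap L, hg', minpoly.aeval]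
  refine (eq_of_monic_of_dvd_of_natDegree_le (minpoly.monic hcL) ((minpoly.monic hc).map _) hdvd
    ?_)
  rw [← hg', natDegree_map, natDegree_map]
  exact natDegree_le_natDegree (minpoly.min F c hm h0)

/-- If the perfect field `F` is algebraically closed in `L`, then `L` is linearly disjoint from
every algebraic extension of `F`. -/
theorem IntermediateField.linearDisjoint_of_forall_isIntegral [PerfectField F]
    (hL : ∀ x : L, IsIntegral F x → x ∈ Set.range (algebraMap F L))
    (A : IntermediateField F K) [Algebra.IsAlgebraic F A] : A.LinearDisjoint L := by
  have : Algebra.IsIntegral F A.toSubalgebra := inferInstanceAs (Algebra.IsIntegral F A)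
  refine Subalgebra.LinearDisjoint.of_linearDisjoint_finite_left _ _ fun A' hA' hfin => ?_
  let B : IntermediateField F K := A'.toIntermediateField' (by
    have := Algebra.IsIntegral.of_finite F A'
    exact isField_of_isIntegral_of_isField' (Field.toIsField F))
  have hBfin : FiniteDimensional F B := hfin
  let pb := Field.powerBasisOfFiniteOfSeparable F B
  have hdim : (minpoly L (pb.gen : K)).natDegree = pb.dim := by
    have h1 : minpoly F (pb.gen : K) = minpoly F pb.gen :=
      minpoly.algebraMap_eq (algebraMap B K).injective pb.gen
    have hi : IsIntegral F (pb.gen : K) :=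
      (Algebra.IsIntegral.isIntegral (R := F) pb.gen).map B.val
    rw [← minpoly.map_eq_of_forall_isIntegral hL hi, natDegree_map]
    exact (congrArg natDegree h1).trans pb.natDegree_minpoly
  have : B.LinearDisjoint L := by
    refine IntermediateField.LinearDisjoint.of_basis_left pb.basis ?_
    have h1 := (linearIndependent_pow (K := L) (pb.gen : K)).comp (Fin.cast hdim.symm)
      (Fin.cast_injective _)
    convert h1 using 1
    funext i
    simp
  exact this

/-- If the perfect field `F` is algebraically closed in `L`, then an endomorphism of an algebraic
extension `k` of `F` extends to an `L`-linear endomorphism of the compositum of `k` and `L`. -/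
theorem exists_algHom_extend [PerfectField F] {k : Type*} [Field k] [Algebra F k]
    [Algebra.IsAlgebraic F k] [Algebra k K] [IsScalarTower F k K]
    (hL : ∀ x : L, IsIntegral F x → x ∈ Set.range (algebraMap F L))
    (htop : Algebra.adjoin L (Set.range (algebraMap k K)) = ⊤) (σ : k →ₐ[F] k) :
    ∃ τ : K →ₐ[L] K, ∀ c, τ (algebraMap k K c) = algebraMap k K (σ c) := by
  let j : k →ₐ[F] K := IsScalarTower.toAlgHom F k K
  have hj : Function.Injective j := (algebraMap k K).injective
  let A : IntermediateField F K := j.fieldRange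
  have : Algebra.IsAlgebraic F A := (AlgEquiv.ofInjectiveField j).isAlgebraic
  have H : A.LinearDisjoint L := IntermediateField.linearDisjoint_of_forall_isIntegral hL A
  let μ : TensorProduct F L k →ₐ[L] K :=
    Algebra.TensorProduct.lift (Algebra.ofId L K) j fun _ _ => Commute.all _ _
  have hμ : ∀ l c, μ (l ⊗ₜ[F] c) = algebraMap L K l * algebraMap k K c := fun l c => by
    simp [μ, j, Algebra.ofId_apply]
  let b := Module.Basis.ofVectorSpace F k
  have hinj : Function.Injective μ := by
    have h1 : LinearIndependent F fun i => (AlgEquiv.ofInjectiveField j) (b i) :=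
      b.linearIndependent.map' (AlgEquiv.ofInjectiveField j).toLinearMap
        (LinearMap.ker_eq_bot.2 (AlgEquiv.ofInjectiveField j).injective)
    have h2 := H.linearIndependent_left h1
    have h3 : LinearIndependent L fun i => μ (Algebra.TensorProduct.basis L b i) := by
      convert h2 using 1
      funext i
      rw [Algebra.TensorProduct.basis_apply, hμ, map_one, one_mul]
      rfl
    have h4 : (Algebra.TensorProduct.basis L b).constr L
        (fun i => μ (Algebra.TensorProduct.basis L b i)) = μ.toLinearMap :=
      (Algebra.TensorProduct.basis L b).ext fun i => (Algebra.TensorProduct.basis L b).constr_basis ..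
    have h5 := (Algebra.TensorProduct.basis L b).injective_constr_of_linearIndependent (R₂ := L) h3
    rw [h4] at h5
    exact h5
  have hsurj : Function.Surjective μ := by
    rw [← AlgHom.range_eq_top, eq_top_iff, ← htop]
    refine Algebra.adjoin_le ?_
    rintro _ ⟨c, rfl⟩
    exact ⟨1 ⊗ₜ c, by simp [hμ]⟩
  let e := AlgEquiv.ofBijective μ ⟨hinj, hsurj⟩
  refine ⟨((e : _ →ₐ[L] K).comp (Algebra.TensorProduct.map (AlgHom.id L L) σ)).comp
    (e.symm : K →ₐ[L] _), fun c => ?_⟩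
  have h1 : ∀ c, e.symm (algebraMap k K c) = 1 ⊗ₜ c := fun c => by
    rw [AlgEquiv.symm_apply_eq]
    exact (by simp [hμ] : algebraMap k K c = μ (1 ⊗ₜ c))
  have h2 : e (1 ⊗ₜ σ c) = algebraMap k K (σ c) := by
    rw [← h1, AlgEquiv.apply_symm_apply]
  simp [h1, h2]

end Regular

section Semilinear

/-- A ring homomorphism to a field over which `f` splits extends to the splitting field of `f`. -/
theorem Polynomial.IsSplittingField.exists_ringHom_lift {E L M : Type*} [Field E] [Field L]
    [Field M] [Algebra E L] (f : E[X]) [IsSplittingField E L f] (j : E →+* M)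
    (hj : (f.map j).Splits) : ∃ θ : L →+* M, ∀ x, θ (algebraMap E L x) = j x := by
  let := j.toAlgebra
  exact ⟨(IsSplittingField.lift L f hj : L →ₐ[E] M), fun x => AlgHom.commutes _ x⟩

variable {k E K : Type*} [Field k] [Field E] [Field K] [Algebra k[X] E]
  [IsFractionRing k[X] E] [Algebra E K] [Algebra k[X] K] [IsScalarTower k[X] E K]

include E in
/-- An injective ring homomorphism from `k[X]` to a field over which `f` splits extends to the
splitting field of `f` over the fraction field of `k[X]`. -/
theorem exists_ringHom_extend (f : k[X][X]) [IsSplittingField E K (f.map (algebraMap k[X] E))]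
    {M : Type*} [Field M] (g : k[X] →+* M) (hg : Function.Injective g) (hs : (f.map g).Splits) :
    ∃ θ : K →+* M, ∀ a, θ (algebraMap k[X] K a) = g a := by
  have h1 : (IsFractionRing.lift hg : E →+* M).comp (algebraMap k[X] E) = g :=
    RingHom.ext fun a => IsFractionRing.lift_algebraMap hg a
  obtain ⟨θ, hθ⟩ := IsSplittingField.exists_ringHom_lift (L := K) (f.map (algebraMap k[X] E))
    (IsFractionRing.lift hg : E →+* M) (by rwa [map_map, h1])
  refine ⟨θ, fun a => ?_⟩
  rw [IsScalarTower.algebraMap_apply k[X] E K, hθ, IsFractionRing.lift_algebraMap]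

variable (E K) in
include E in
theorem algebraMap_polynomial_injective : Function.Injective (algebraMap k[X] K) := by
  rw [IsScalarTower.algebraMap_eq k[X] E K]
  exact (algebraMap E K).injective.comp (FaithfulSMul.algebraMap_injective k[X] E)

omit [IsFractionRing k[X] E] in
theorem splits_map_algebraMap (f : k[X][X]) [IsSplittingField E K (f.map (algebraMap k[X] E))] :
    (f.map (algebraMap k[X] K)).Splits := by
  have := IsSplittingField.splits K (f.map (algebraMap k[X] E))
  rwa [map_map, ← IsScalarTower.algebraMap_eq] at this

/-- Some power of any ring endomorphism permuting the roots of `f` fixes all of them. -/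
theorem exists_pow_fixes_rootSet (f : k[X][X]) (θ : K →+* K) (σ : k →+* k)
    (hσ : f.map (mapRingHom σ) = f)
    (hθ : ∀ a : k[X], θ (algebraMap k[X] K a) = algebraMap k[X] K (a.map σ)) :
    ∃ m : ℕ, 1 ≤ m ∧ ∀ s ∈ f.rootSet K, (θ ^ m) s = s := by
  have hmem : ∀ s ∈ f.rootSet K, θ s ∈ f.rootSet K := by
    intro s hs
    rw [mem_rootSet'] at hs ⊢
    refine ⟨hs.1, ?_⟩
    have h1 : θ.comp (algebraMap k[X] K) = (algebraMap k[X] K).comp (mapRingHom σ) :=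
      RingHom.ext hθ
    have h2 := congrArg θ hs.2
    rw [aeval_def, hom_eval₂, h1, ← eval₂_map, hσ, map_zero] at h2
    exact h2
  have hfin : Finite (f.rootSet K) := rootSet_finite f K
  let e : Equiv.Perm (f.rootSet K) := Equiv.ofBijective
    (fun s => ⟨θ s, hmem s s.2⟩) (Finite.injective_iff_bijective.1 fun a b h =>
      Subtype.ext (θ.injective (congrArg Subtype.val h)))
  refine ⟨orderOf e, orderOf_pos e, fun s hs => ?_⟩
  have h1 : ∀ n (s : f.rootSet K), ((e ^ n) s : K) = (θ ^ n) s := by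
    intro n
    induction n with
    | zero => intro s; simp
    | succ n ih => intro s; rw [pow_succ, pow_succ, Equiv.Perm.mul_apply, ih]; rfl
  rw [← h1 _ ⟨s, hs⟩, pow_orderOf_eq_one]
  rfl

theorem pow_apply_algebraMap {θ : K →+* K} {p r : ℕ} [ExpChar k p]
    (hθ : ∀ a : k[X], θ (algebraMap k[X] K a) =
      algebraMap k[X] K (a.map (iterateFrobenius k p r))) (n : ℕ) (a : k[X]) :
    (θ ^ n) (algebraMap k[X] K a) = algebraMap k[X] K (a.map (iterateFrobenius k p (r * n))) := by
  induction n generalizing a with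
  | zero => simp [iterateFrobenius_zero]
  | succ n ih =>
    rw [pow_succ, RingHom.mul_def, RingHom.comp_apply, hθ, ih, map_map, mul_add_one,
      iterateFrobenius_add]

include E in
/-- Some power of the `p ^ r`-power Frobenius on coefficients lifts to an endomorphism of the
splitting field of `f` that fixes the roots of `f`. -/
theorem exists_semilinear_fixing_roots (f : k[X][X])
    [IsSplittingField E K (f.map (algebraMap k[X] E))] {p r : ℕ} [ExpChar k p]
    (hσ : f.map (mapRingHom (iterateFrobenius k p r)) = f) :
    ∃ m : ℕ, 1 ≤ m ∧ ∃ τ : K →+* K, (∀ a : k[X], τ (algebraMap k[X] K a) =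
      algebraMap k[X] K (a.map (iterateFrobenius k p (r * m)))) ∧ ∀ s ∈ f.rootSet K, τ s = s := by
  obtain ⟨θ, hθ⟩ := exists_ringHom_extend (E := E) (K := K) f
    ((algebraMap k[X] K).comp (mapRingHom (iterateFrobenius k p r)))
    ((algebraMap_polynomial_injective E K).comp
      (map_injective _ (iterateFrobenius k p r).injective))
    (by rw [← map_map, hσ]; exact splits_map_algebraMap (E := E) f)
  obtain ⟨m, hm, h⟩ := exists_pow_fixes_rootSet f θ (iterateFrobenius k p r) hσ hθ
  exact ⟨m, hm, θ ^ m, pow_apply_algebraMap hθ m, h⟩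

end Semilinear

section Geometric

variable {k E K : Type*} [Field k] [Field E] [Field K] [Algebra k[X] E]
  [IsFractionRing k[X] E] [Algebra E K] [Algebra k[X] K] [IsScalarTower k[X] E K]
  [Algebra k K] [IsScalarTower k k[X] K]
  {F E₀ L : Type*} [Field F] [Field E₀] [Field L] [Algebra F[X] E₀] [IsFractionRing F[X] E₀]
  [Algebra E₀ L] [Algebra F[X] L] [IsScalarTower F[X] E₀ L] [Algebra F L] [IsScalarTower F F[X] L]

include E E₀ in
/-- If `F` is algebraically closed in the splitting field `L` of `f` over `F(t)`, then any
`F`-endomorphism of an algebraic extension `k` lifts to an endomorphism of the splitting field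
of `f` over `k(t)` that fixes `t` and the roots of `f`. -/
theorem exists_lift_fixing_roots [PerfectField F] [Algebra F k] [Algebra.IsAlgebraic F k]
    (f : F[X][X]) [IsSplittingField E₀ L (f.map (algebraMap F[X] E₀))]
    [IsSplittingField E K ((f.map (mapRingHom (algebraMap F k))).map (algebraMap k[X] E))]
    (hL : ∀ x : L, IsIntegral F x → x ∈ Set.range (algebraMap F L)) (σ : k →ₐ[F] k) :
    ∃ τ : K →+* K, (∀ a : k[X], τ (algebraMap k[X] K a) = algebraMap k[X] K (a.map σ)) ∧
      ∀ s ∈ (f.map (mapRingHom (algebraMap F k))).rootSet K, τ s = s := by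
  set f' := f.map (mapRingHom (algebraMap F k)) with hf'
  let g : F[X] →+* K := (algebraMap k[X] K).comp (mapRingHom (algebraMap F k))
  have hg : Function.Injective g := (algebraMap_polynomial_injective E K).comp
    (map_injective _ (algebraMap F k).injective)
  have hfg : f.map g = f'.map (algebraMap k[X] K) := by rw [hf', map_map]
  obtain ⟨ι, hι⟩ := exists_ringHom_extend (E := E₀) (K := L) f g hg
    (by rw [hfg]; exact splits_map_algebraMap (E := E) f')
  let : Algebra L K := ι.toAlgebra
  let : Algebra F K := ((algebraMap k K).comp (algebraMap F k)).toAlgebra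
  have : IsScalarTower F k K := IsScalarTower.of_algebraMap_eq fun _ => rfl
  have hιC : ∀ c : F, ι (algebraMap F L c) = algebraMap k K (algebraMap F k c) := by
    intro c
    rw [IsScalarTower.algebraMap_apply F F[X] L, hι, IsScalarTower.algebraMap_apply k k[X] K]
    simp [g]
  have : IsScalarTower F L K := IsScalarTower.of_algebraMap_eq fun c => (hιC c).symm
  have hιX : ι (algebraMap F[X] L X) = algebraMap k[X] K X := by
    rw [hι]
    simp [g]
  have hroot : ∀ s ∈ f'.rootSet K, s ∈ Set.range ι := by
    intro s hs
    let : Algebra F[X] K := g.toAlgebra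
    have hιg : ι.comp (algebraMap F[X] L) = algebraMap F[X] K := RingHom.ext hι
    let ι' : L →ₐ[F[X]] K := { ι with commutes' := hι }
    have h1 : s ∈ f.rootSet K := by
      rw [mem_rootSet'] at hs ⊢
      refine ⟨?_, ?_⟩
      · have := hs.1
        rwa [← hfg] at this
      · have := hs.2
        rwa [aeval_def, eval₂_eq_eval_map, ← hfg, ← eval₂_eq_eval_map] at this
    rw [← (splits_map_algebraMap (E := E₀) f).image_rootSet ι'] at h1
    obtain ⟨x, -, hx⟩ := h1
    exact ⟨x, hx⟩
  have htop : Algebra.adjoin L (Set.range (algebraMap k K)) = ⊤ := by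
    have halg : ∀ x ∈ Set.range (algebraMap k K), IsAlgebraic L x := by
      rintro _ ⟨c, rfl⟩
      have : IsAlgebraic F (algebraMap k K c) :=
        (Algebra.IsAlgebraic.isAlgebraic (R := F) c).algebraMap
      exact this.tower_top L
    rw [← IntermediateField.adjoin_toSubalgebra_of_isAlgebraic halg]
    set B := IntermediateField.adjoin L (Set.range (algebraMap k K)) with hB
    have hBL : ∀ x, ι x ∈ B := fun x => B.algebraMap_mem x
    have hBk : ∀ c, algebraMap k K c ∈ B := fun c =>
      IntermediateField.subset_adjoin _ _ ⟨c, rfl⟩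
    have hBp : ∀ a : k[X], algebraMap k[X] K a ∈ B := by
      intro a
      induction a using Polynomial.induction_on' with
      | add a b ha hb => rw [map_add]; exact add_mem ha hb
      | monomial n c =>
        rw [← C_mul_X_pow_eq_monomial, map_mul, map_pow, ← hιX, ← algebraMap_eq,
          ← IsScalarTower.algebraMap_apply k k[X] K]
        exact mul_mem (hBk c) (pow_mem (hBL _) n)
    have hBE : ∀ x : E, algebraMap E K x ∈ B.toSubfield := by
      intro x
      obtain ⟨a, b, -, rfl⟩ := IsFractionRing.div_surjective k[X] x
      rw [map_div₀, ← IsScalarTower.algebraMap_apply, ← IsScalarTower.algebraMap_apply]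
      exact div_mem (hBp a) (hBp b)
    let B' : IntermediateField E K := B.toSubfield.toIntermediateField hBE
    have h2 : (⊤ : Subalgebra E K) ≤ B'.toSubalgebra := by
      rw [← IsSplittingField.adjoin_rootSet K (f'.map (algebraMap k[X] E))]
      refine Algebra.adjoin_le fun s hs => ?_
      have hs' : s ∈ f'.rootSet K := by
        rw [mem_rootSet', map_map, ← IsScalarTower.algebraMap_eq, aeval_map_algebraMap] at hs
        rwa [mem_rootSet']
      obtain ⟨x, rfl⟩ := hroot s hs'
      exact hBL x
    exact eq_top_iff.2 fun x _ => h2 (Algebra.mem_top : x ∈ (⊤ : Subalgebra E K))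
  obtain ⟨τ, hτ⟩ := exists_algHom_extend hL htop σ
  have hτι : ∀ x, τ (ι x) = ι x := τ.commutes
  refine ⟨τ, fun a => ?_, fun s hs => ?_⟩
  · have : (τ : K →+* K).comp (algebraMap k[X] K) =
        (algebraMap k[X] K).comp (mapRingHom (σ : k →+* k)) := by
      refine ringHom_ext (fun c => ?_) ?_
      · simp only [RingHom.comp_apply, coe_mapRingHom, map_C]
        rw [← algebraMap_eq, ← IsScalarTower.algebraMap_apply k k[X] K,
          ← IsScalarTower.algebraMap_apply k k[X] K]
        exact hτ c
      · simp only [RingHom.comp_apply, coe_mapRingHom, map_X]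
        rw [← hιX]
        exact hτι _
    exact RingHom.congr_fun this a
  · obtain ⟨x, rfl⟩ := hroot s hs
    exact hτι x

end Geometric

section Dynamics

variable {k : Type*} [Field k]

open Classical in
/-- The point `[a : b]` of the projective line. -/
noncomputable def projPoint (a b : k) : Option k := if b = 0 then none else some (a / b)

/-- The value at `(a, b)` of the homogenization of `p` of degree `d`. -/
def homEval (d : ℕ) (p : k[X]) (a b : k) : k :=
  ∑ i ∈ Finset.range (d + 1), p.coeff i * a ^ i * b ^ (d - i)

theorem homEval_of_ne_zero {d : ℕ} {p : k[X]} (hp : p.natDegree ≤ d) (a : k) {b : k} (hb : b ≠ 0) :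
    homEval d p a b = b ^ d * p.eval (a / b) := by
  rw [homEval, eval_eq_sum_range' (Nat.lt_succ_of_le hp), Finset.mul_sum]
  refine Finset.sum_congr rfl fun i hi => ?_
  have hi' : i ≤ d := Nat.lt_succ_iff.1 (Finset.mem_range.1 hi)
  rw [← Nat.sub_add_cancel hi', pow_add, Nat.add_sub_cancel, div_pow]
  field_simp

theorem homEval_zero_right (d : ℕ) (p : k[X]) (a : k) : homEval d p a 0 = p.coeff d * a ^ d := by
  rw [homEval, Finset.sum_eq_single_of_mem d (by simp)]
  · simp
  · intro i hi hid
    have : d - i ≠ 0 := by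
      have := Finset.mem_range.1 hi
      omega
    simp [this]

theorem homEval_ne_zero {p q : k[X]} (hco : IsCoprime p q)
    (hd : 1 ≤ max p.natDegree q.natDegree) {a b : k} (hab : a ≠ 0 ∨ b ≠ 0) :
    homEval (max p.natDegree q.natDegree) p a b ≠ 0 ∨
      homEval (max p.natDegree q.natDegree) q a b ≠ 0 := by
  by_cases hb : b = 0
  · subst hb
    have ha : a ≠ 0 := by simpa using hab
    rw [homEval_zero_right, homEval_zero_right]
    rcases max_cases p.natDegree q.natDegree with ⟨h, h'⟩ | ⟨h, h'⟩
    · left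
      rw [h] at hd ⊢
      have : p ≠ 0 := by rintro rfl; simp at hd
      exact mul_ne_zero (leadingCoeff_ne_zero.2 this) (pow_ne_zero _ ha)
    · right
      rw [h] at hd ⊢
      have : q ≠ 0 := by rintro rfl; simp at hd
      exact mul_ne_zero (leadingCoeff_ne_zero.2 this) (pow_ne_zero _ ha)
  · rw [homEval_of_ne_zero (le_max_left _ _) a hb, homEval_of_ne_zero (le_max_right _ _) a hb]
    by_contra! h
    obtain ⟨u, v, huv⟩ := hco
    have h1 := congrArg (eval (a / b)) huv
    have hbd := pow_ne_zero (max p.natDegree q.natDegree) hb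
    rw [eval_add, eval_mul, eval_mul, (mul_eq_zero.1 h.1).resolve_left hbd,
      (mul_eq_zero.1 h.2).resolve_left hbd] at h1
    simp at h1

theorem projPoint_homEval {p q : k[X]} (hd : 1 ≤ max p.natDegree q.natDegree) {a b : k}
    (hab : a ≠ 0 ∨ b ≠ 0) :
    projPoint (homEval (max p.natDegree q.natDegree) p a b)
      (homEval (max p.natDegree q.natDegree) q a b) = ratMapP1 p q (projPoint a b) := by
  by_cases hb : b = 0
  · subst hb
    have ha : a ≠ 0 := by simpa using hab
    rw [homEval_zero_right, homEval_zero_right]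
    rcases lt_trichotomy p.natDegree q.natDegree with h | h | h
    · have hq : q ≠ 0 := by rintro rfl; simp at h
      rw [max_eq_right h.le, coeff_eq_zero_of_natDegree_lt h]
      simp [projPoint, ratMapP1, h, h.le.not_gt, ha, hq]
    · rw [h, max_self] at hd ⊢
      have hq : q ≠ 0 := by rintro rfl; simp at hd
      have hp : p.coeff q.natDegree = p.leadingCoeff := by rw [leadingCoeff, h]
      rw [hp]
      simp [projPoint, ratMapP1, h, ha, hq]
      field_simp
    · rw [max_eq_left h.le, coeff_eq_zero_of_natDegree_lt h]
      simp [projPoint, ratMapP1, h]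
  · rw [homEval_of_ne_zero (le_max_left _ _) a hb, homEval_of_ne_zero (le_max_right _ _) a hb]
    by_cases hq : q.eval (a / b) = 0
    · simp [projPoint, ratMapP1, hb, hq]
    · simp only [projPoint, ratMapP1, hb, hq, mul_eq_zero, pow_eq_zero_iff', if_false, false_and,
        or_false]
      congr 1
      field_simp

theorem eval_pairComp_fst (p q r s : k[X]) (x : k) : (pairComp p q r s).1.eval x =
    homEval (max p.natDegree q.natDegree) p (r.eval x) (s.eval x) := by
  simp [pairComp, homEval, eval_finsetSum]

theorem eval_pairComp_snd (p q r s : k[X]) (x : k) : (pairComp p q r s).2.eval x =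
    homEval (max p.natDegree q.natDegree) q (r.eval x) (s.eval x) := by
  simp [pairComp, homEval, eval_finsetSum]

theorem eval_iterPair_ne_zero {p q : k[X]} (hco : IsCoprime p q)
    (hd : 1 ≤ max p.natDegree q.natDegree) (x : k) (n : ℕ) :
    (iterPair p q n).1.eval x ≠ 0 ∨ (iterPair p q n).2.eval x ≠ 0 := by
  induction n with
  | zero => simp [iterPair]
  | succ n ih =>
    rw [iterPair, eval_pairComp_fst, eval_pairComp_snd]
    exact homEval_ne_zero hco hd ih

theorem iterate_ratMapP1_some {p q : k[X]} (hco : IsCoprime p q)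
    (hd : 1 ≤ max p.natDegree q.natDegree) (x : k) (n : ℕ) :
    (ratMapP1 p q)^[n] (some x) =
      projPoint ((iterPair p q n).1.eval x) ((iterPair p q n).2.eval x) := by
  induction n with
  | zero => simp [iterPair, projPoint]
  | succ n ih =>
    rw [Function.iterate_succ_apply', ih, iterPair, eval_pairComp_fst, eval_pairComp_snd,
      projPoint_homEval hd (eval_iterPair_ne_zero hco hd x n)]

theorem ratMapP1_optionMap {p q : k[X]} (σ : k →+* k) (hp : p.map σ = p) (hq : q.map σ = q)
    (z : Option k) : ratMapP1 p q (z.map σ) = (ratMapP1 p q z).map σ := by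
  have hev : ∀ {r : k[X]}, r.map σ = r → ∀ a, r.eval (σ a) = σ (r.eval a) := fun h a => by
    conv_lhs => rw [← h]
    rw [eval_map, eval₂_hom]
  have hlc : ∀ {r : k[X]}, r.map σ = r → σ r.leadingCoeff = r.leadingCoeff := fun {r} h => by
    rw [← leadingCoeff_map σ, h]
  cases z with
  | none =>
    simp only [ratMapP1, Option.map_none]
    split_ifs <;> simp [hlc hp, hlc hq]
  | some a =>
    have h0 : q.eval (σ a) = 0 ↔ q.eval a = 0 := by rw [hev hq, map_eq_zero]
    by_cases h : q.eval a = 0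
    · simp [ratMapP1, h0, h]
    · simp [ratMapP1, h, hev hp, hev hq]

theorem map_pairComp {K K' : Type*} [Field K] [Field K'] (σ : K →+* K') (p q r s : K[X]) :
    pairComp (p.map σ) (q.map σ) (r.map σ) (s.map σ) =
      ((pairComp p q r s).1.map σ, (pairComp p q r s).2.map σ) := by
  simp [pairComp, Polynomial.map_sum]

theorem map_iterPair {K K' : Type*} [Field K] [Field K'] (σ : K →+* K') (p q : K[X]) (n : ℕ) :
    iterPair (p.map σ) (q.map σ) n = ((iterPair p q n).1.map σ, (iterPair p q n).2.map σ) := by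
  induction n with
  | zero => simp [iterPair]
  | succ n ih => rw [iterPair, ih, map_pairComp, iterPair]

/-- The numerator of `φ ^ n (x) - t` as a polynomial in `x` over `K[t]`. -/
noncomputable def iterNumerator {K : Type*} [Field K] (p q : K[X]) (n : ℕ) : K[X][X] :=
  (iterPair p q n).1.map C - C X * (iterPair p q n).2.map C

theorem map_iterNumerator_ratFunc {K : Type*} [Field K] (p q : K[X]) (n : ℕ) :
    (iterNumerator p q n).map (algebraMap K[X] (RatFunc K)) = PhiPoly K p q n := by
  have : (algebraMap K[X] (RatFunc K)).comp C = RatFunc.C := rfl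
  simp [iterNumerator, PhiPoly, map_map, this]

theorem map_iterNumerator {K K' : Type*} [Field K] [Field K'] (σ : K →+* K') (p q : K[X]) (n : ℕ) :
    (iterNumerator p q n).map (mapRingHom σ) = iterNumerator (p.map σ) (q.map σ) n := by
  simp [iterNumerator, map_map, map_iterPair, mapRingHom_comp_C]

theorem eval₂_iterNumerator (p q : k[X]) (n : ℕ) (a x : k) :
    (iterNumerator p q n).eval₂ (evalRingHom a) x =
      (iterPair p q n).1.eval x - a * (iterPair p q n).2.eval x := by
  have : (evalRingHom a).comp C = RingHom.id k := RingHom.ext fun c => by simp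
  rw [iterNumerator, eval₂_sub, eval₂_mul, eval₂_C, eval₂_map, eval₂_map, this]
  simp [eval₂_id]

theorem iterNumerator_ne_zero {p q : k[X]} (hco : IsCoprime p q)
    (hd : 1 ≤ max p.natDegree q.natDegree) (n : ℕ) : iterNumerator p q n ≠ 0 := by
  intro h
  have h1 : ∀ a, (iterPair p q n).1.eval 0 - a * (iterPair p q n).2.eval 0 = 0 := fun a => by
    rw [← eval₂_iterNumerator, h, eval₂_zero]
  have h2 := h1 0
  have h3 := h1 1
  rcases eval_iterPair_ne_zero hco hd 0 n with h4 | h4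
  · exact h4 (by simpa using h2)
  · refine h4 ?_
    linear_combination h2 - h3

/-- A rational point that is periodic under `φ` is an `n`-fold image of a rational point; hence
up to two exceptions it is a parameter at which `φ ^ n (x) - t` has a rational zero. -/
theorem ncard_periodic_le {p q : k[X]} (hco : IsCoprime p q)
    (hd : 1 ≤ max p.natDegree q.natDegree) (n Q : ℕ) (hQ : 1 < Q) (σ : k →+* k)
    (hσ : ∀ a, σ a = a ^ Q) (hp : p.map σ = p) (hq : q.map σ = q) :
    {α : Option k | (α = none ∨ ∃ a, α = some a ∧ a ^ Q = a) ∧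
      ∃ m, 1 ≤ m ∧ (ratMapP1 p q)^[m] α = α}.ncard ≤
    {t₀ : k | t₀ ^ Q = t₀ ∧ ∃ x₀, x₀ ^ Q = x₀ ∧
      (iterNumerator p q n).eval₂ (evalRingHom t₀) x₀ = 0}.ncard + 2 := by
  set T := {t₀ : k | t₀ ^ Q = t₀ ∧ ∃ x₀, x₀ ^ Q = x₀ ∧
      (iterNumerator p q n).eval₂ (evalRingHom t₀) x₀ = 0} with hT
  have hTfin : T.Finite := by
    refine (rootSet_finite (X ^ Q - X : k[X]) k).subset fun t ht => ?_
    rw [mem_rootSet]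
    exact ⟨FiniteField.X_pow_card_sub_X_ne_zero k hQ, by simp [ht.1]⟩
  have hcomm : ∀ m (z : Option k), (ratMapP1 p q)^[m] (z.map σ) = ((ratMapP1 p q)^[m] z).map σ := by
    intro m
    induction m with
    | zero => intro z; rfl
    | succ m ih =>
      intro z
      rw [Function.iterate_succ_apply, ratMapP1_optionMap σ hp hq, ih, Function.iterate_succ_apply]
  have hsub : {α : Option k | (α = none ∨ ∃ a, α = some a ∧ a ^ Q = a) ∧
      ∃ m, 1 ≤ m ∧ (ratMapP1 p q)^[m] α = α} ⊆
      some '' T ∪ {none, (ratMapP1 p q)^[n] none} := by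
    rintro α ⟨hα, m, hm, hper⟩
    have hαs : α.map σ = α := by
      rcases hα with rfl | ⟨a, rfl, ha⟩
      · rfl
      · simp [hσ, ha]
    set β := (ratMapP1 p q)^[m * n - n] α with hβ
    have hβs : β.map σ = β := by rw [hβ, ← hcomm, hαs]
    have hαβ : (ratMapP1 p q)^[n] β = α := by
      rw [hβ, ← Function.iterate_add_apply, Nat.add_sub_cancel' (Nat.le_mul_of_pos_left n hm),
        Function.iterate_mul]
      exact Function.iterate_fixed hper n
    rcases hα with rfl | ⟨a, rfl, ha⟩
    · simp
    · rcases hβ' : β with _ | x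
      · rw [hβ'] at hαβ
        simp [hαβ]
      · left
        rw [hβ'] at hαβ hβs
        have hx : x ^ Q = x := by simpa [hσ] using hβs
        refine ⟨a, ⟨ha, x, hx, ?_⟩, rfl⟩
        rw [iterate_ratMapP1_some hco hd, projPoint] at hαβ
        split_ifs at hαβ with h0
        rw [eval₂_iterNumerator, ← Option.some.inj hαβ]
        field_simp
        simp
  calc _ ≤ (some '' T ∪ {none, (ratMapP1 p q)^[n] none}).ncard :=
        Set.ncard_le_ncard hsub ((hTfin.image _).union (Set.toFinite _))
    _ ≤ (some '' T).ncard + ({none, (ratMapP1 p q)^[n] none} : Set (Option k)).ncard :=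
        Set.ncard_union_le _ _
    _ ≤ _ := add_le_add (Set.ncard_image_le hTfin) (Set.ncard_insert_le _ _ |>.trans (by simp))

end Dynamics

section Count

theorem iterateFrobenius_algebraMap {F k : Type*} [Field F] [Fintype F] [Field k] [Algebra F k]
    {ℓ r : ℕ} [ExpChar k ℓ] (hcard : Fintype.card F = ℓ ^ r) (m : ℕ) (c : F) :
    iterateFrobenius k ℓ (r * m) (algebraMap F k c) = algebraMap F k c := by
  rw [iterateFrobenius_def, pow_mul, ← hcard, ← map_pow, FiniteField.pow_card_pow]

variable {F : Type*} [Field F] (p q : F[X]) (n : ℕ)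

/-- The numerator of `φ ^ n (x) - t` over the algebraic closure. -/
noncomputable abbrev geomNumerator : (AlgebraicClosure F)[X][X] :=
  iterNumerator (p.map (algebraMap F (AlgebraicClosure F)))
    (q.map (algebraMap F (AlgebraicClosure F))) n

/-- The geometric splitting field of `φ ^ n (x) - t`. -/
abbrev geomField : Type _ :=
  (PhiPoly (AlgebraicClosure F) (p.map (algebraMap F (AlgebraicClosure F)))
    (q.map (algebraMap F (AlgebraicClosure F))) n).SplittingField

instance isScalarTower_polynomial_splittingField {K : Type*} [Field K] (f : (RatFunc K)[X]) :
    IsScalarTower K K[X] f.SplittingField :=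
  IsScalarTower.of_algebraMap_eq fun x => by
    rw [IsScalarTower.algebraMap_apply K (RatFunc K) f.SplittingField,
      IsScalarTower.algebraMap_apply K[X] (RatFunc K) f.SplittingField,
      IsScalarTower.algebraMap_apply K K[X] (RatFunc K)]

instance isSplittingField_iterNumerator {K : Type*} [Field K] (p q : K[X]) (n : ℕ) :
    IsSplittingField (RatFunc K) (PhiPoly K p q n).SplittingField
      ((iterNumerator p q n).map (algebraMap K[X] (RatFunc K))) := by
  rw [map_iterNumerator_ratFunc]
  infer_instance

theorem rootSet_iterNumerator {K M : Type*} [Field K] [Field M] [Algebra (RatFunc K) M]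
    [Algebra K[X] M] [IsScalarTower K[X] (RatFunc K) M] (p q : K[X]) (n : ℕ) :
    (iterNumerator p q n).rootSet M = (PhiPoly K p q n).rootSet M := by
  ext s
  rw [mem_rootSet', mem_rootSet', ← map_iterNumerator_ratFunc, map_map,
    ← IsScalarTower.algebraMap_eq, aeval_map_algebraMap]

variable {p q}

theorem exists_perCount_le [Fintype F] (hco : IsCoprime p q) (hd : 1 ≤ max p.natDegree q.natDegree)
    {ℓ r M : ℕ} [Fact ℓ.Prime] [CharP (AlgebraicClosure F) ℓ] (hr : 1 ≤ r) (hM : 1 ≤ M)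
    (hcard : Fintype.card F = ℓ ^ r)
    (hτ : ∃ τ : geomField p q n →+* geomField p q n,
      (∀ a : (AlgebraicClosure F)[X], τ (algebraMap _ _ a) =
        algebraMap _ _ (a.map (iterateFrobenius (AlgebraicClosure F) ℓ (r * M)))) ∧
      ∀ s ∈ (geomNumerator p q n).rootSet (geomField p q n), τ s = s) {ε : ℝ} (hε : 0 < ε) :
    ∃ C N₀ : ℕ, ∀ j ≥ N₀, (perCount F p q (M * j) : ℝ) ≤
      FPPgeo F p q n * (1 + ε) * (Fintype.card F : ℝ) ^ (M * j) + C := by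
  obtain ⟨τ, hτ, hfix⟩ := hτ
  set k := AlgebraicClosure F
  set pk := p.map (algebraMap F k) with hpk
  set qk := q.map (algebraMap F k) with hqk
  have hcok : IsCoprime pk qk := hco.map (mapRingHom (algebraMap F k))
  have hdk : 1 ≤ max pk.natDegree qk.natDegree := by
    rwa [hpk, hqk, natDegree_map, natDegree_map]
  have hstab : ∀ (m : ℕ) (g : F[X]), (g.map (algebraMap F k)).map
      (iterateFrobenius k ℓ (r * m)) = g.map (algebraMap F k) := fun m g => by
    rw [map_map]
    congr 1
    exact RingHom.ext (iterateFrobenius_algebraMap hcard m)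
  have hf0 : iterNumerator pk qk n ≠ 0 := iterNumerator_ne_zero hcok hdk n
  have hgen : ∀ g : geomField p q n ≃ₐ[RatFunc k] geomField p q n,
      (∀ s ∈ (iterNumerator pk qk n).rootSet (geomField p q n), g s = s) → g = 1 := by
    intro g hg
    rw [rootSet_iterNumerator] at hg
    have h1 := SplittingField.adjoin_rootSet (PhiPoly k pk qk n)
    have h2 : (g : geomField p q n →ₐ[RatFunc k] geomField p q n) = AlgHom.id _ _ :=
      AlgHom.ext_of_adjoin_eq_top h1 fun s hs => hg s hs
    exact AlgEquiv.ext fun x => AlgHom.congr_fun h2 x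
  obtain ⟨C, i₀, hC⟩ := exists_ncard_specializations_le_of_ne_zero (E := RatFunc k)
    (K := geomField p q n) ℓ (iterNumerator pk qk n) hf0
    (splits_map_algebraMap (E := RatFunc k) _) hgen hε
  refine ⟨C + 2, max i₀ 1, fun j hj => ?_⟩
  have hj1 : 1 ≤ j := (le_max_right _ _).trans hj
  have hMj : 1 ≤ M * j := Nat.mul_pos hM hj1
  have hi : r * (M * j) ≥ i₀ := ((le_max_left _ _).trans hj).trans
    ((Nat.le_mul_of_pos_left j hM).trans (Nat.le_mul_of_pos_left _ hr))
  have hlead : (iterNumerator pk qk n).leadingCoeff.map (iterateFrobenius k ℓ (r * (M * j))) =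
      (iterNumerator pk qk n).leadingCoeff := by
    have h1 : (iterNumerator pk qk n).map (mapRingHom (iterateFrobenius k ℓ (r * (M * j)))) =
        iterNumerator pk qk n := by
      rw [map_iterNumerator, hpk, hqk, hstab, hstab]
    have h2 := congrArg (fun g => g.coeff (iterNumerator pk qk n).natDegree) h1
    simp only [coeff_map, coe_mapRingHom] at h2
    exact h2
  have key := hC (r * (M * j)) hi hlead (τ ^ j)
    (fun a => by rw [pow_apply_algebraMap hτ, mul_assoc])
    (fun s hs => by rw [RingHom.coe_pow]; exact Function.iterate_fixed (hfix s hs) j)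
  have hQ : ℓ ^ (r * (M * j)) = Fintype.card F ^ (M * j) := by rw [pow_mul, ← hcard]
  have hper : perCount F p q (M * j) ≤ {t₀ : k | t₀ ^ ℓ ^ (r * (M * j)) = t₀ ∧
      ∃ x₀, x₀ ^ ℓ ^ (r * (M * j)) = x₀ ∧
        (iterNumerator pk qk n).eval₂ (evalRingHom t₀) x₀ = 0}.ncard + 2 := by
    rw [hQ]
    exact ncard_periodic_le hcok hdk n (Fintype.card F ^ (M * j))
      (Nat.one_lt_pow (by omega) Fintype.one_lt_card) (iterateFrobenius k ℓ (r * (M * j)))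
      (fun a => by rw [iterateFrobenius_def, hQ]) (hstab _ _) (hstab _ _)
  have hG : (0 : ℝ) < Nat.card (geomField p q n ≃ₐ[RatFunc k] geomField p q n) :=
    Nat.cast_pos.2 Nat.card_pos
  have hG1 : (1 : ℝ) ≤ Nat.card (geomField p q n ≃ₐ[RatFunc k] geomField p q n) :=
    Nat.one_le_cast.2 Nat.card_pos
  have hFPP : FPPgeo F p q n = Nat.card {g : geomField p q n ≃ₐ[RatFunc k] geomField p q n //
      ∃ s ∈ (iterNumerator pk qk n).rootSet (geomField p q n), g s = s} /
      Nat.card (geomField p q n ≃ₐ[RatFunc k] geomField p q n) := by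
    rw [rootSet_iterNumerator]
    rfl
  have hℓ : (ℓ : ℝ) ^ (r * (M * j)) = (Fintype.card F : ℝ) ^ (M * j) := by exact_mod_cast hQ
  rw [hℓ] at key
  have hper' := (Nat.cast_le (α := ℝ)).2 hper
  push_cast at hper' ⊢
  refine hper'.trans ?_
  rw [← add_assoc]
  gcongr
  rw [hFPP, div_mul_eq_mul_div, div_mul_eq_mul_div, ← sub_le_iff_le_add, le_div_iff₀ hG, sub_mul]
  have : (C : ℝ) ≤ C * Nat.card (geomField p q n ≃ₐ[RatFunc k] geomField p q n) :=
    le_mul_of_one_le_right (Nat.cast_nonneg C) hG1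
  linarith

theorem FPPgeo_nonneg {F : Type*} [Field F] (p q : F[X]) (n : ℕ) : 0 ≤ FPPgeo F p q n := by
  rw [FPPgeo]
  positivity

theorem FPPgeo_le_one {F : Type*} [Field F] (p q : F[X]) (n : ℕ) : FPPgeo F p q n ≤ 1 := by
  rw [FPPgeo]
  exact div_le_one_of_le₀ (Nat.cast_le.2 (Finite.card_subtype_le _)) (Nat.cast_nonneg _)

/-- If the Frobenius power `M` lifts to the geometric splitting field fixing all roots, then along
the multiples of `M` the proportion of periodic points is eventually at most `FPPgeo F p q n`, up
to `ε`. -/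
theorem eventually_perCount_div_le [Fintype F] (hco : IsCoprime p q)
    (hd : 1 ≤ max p.natDegree q.natDegree)
    {ℓ r M : ℕ} [Fact ℓ.Prime] [CharP (AlgebraicClosure F) ℓ] (hr : 1 ≤ r) (hM : 1 ≤ M)
    (hcard : Fintype.card F = ℓ ^ r)
    (hτ : ∃ τ : geomField p q n →+* geomField p q n,
      (∀ a : (AlgebraicClosure F)[X], τ (algebraMap _ _ a) =
        algebraMap _ _ (a.map (iterateFrobenius (AlgebraicClosure F) ℓ (r * M)))) ∧
      ∀ s ∈ (geomNumerator p q n).rootSet (geomField p q n), τ s = s) {ε : ℝ} (hε : 0 < ε) :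
    ∀ᶠ j in Filter.atTop, (perCount F p q (M * j) : ℝ) / ((Fintype.card F : ℝ) ^ (M * j) + 1) ≤
      FPPgeo F p q n + ε := by
  obtain ⟨C, N₀, h⟩ := exists_perCount_le n hco hd hr hM hcard hτ (half_pos hε)
  have h1 : (1 : ℝ) < Fintype.card F := Nat.one_lt_cast.2 Fintype.one_lt_card
  have hlim := ((tendsto_pow_atTop_atTop_of_one_lt h1).comp
    (Filter.tendsto_id.const_mul_atTop' hM)).eventually_ge_atTop (C / (ε / 2))
  filter_upwards [hlim, Filter.eventually_ge_atTop N₀] with j hj hjN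
  have hpos : (0 : ℝ) < (Fintype.card F : ℝ) ^ (M * j) + 1 := by positivity
  rw [div_le_iff₀ hpos]
  refine (h j hjN).trans ?_
  have hj' : (C : ℝ) ≤ (Fintype.card F : ℝ) ^ (M * j) * (ε / 2) := (div_le_iff₀ (half_pos hε)).1 hj
  have h2 := FPPgeo_nonneg p q n
  have h3 : FPPgeo F p q n * ((ε / 2) * (Fintype.card F : ℝ) ^ (M * j)) ≤
      1 * ((ε / 2) * (Fintype.card F : ℝ) ^ (M * j)) := by
    gcongr
    exact FPPgeo_le_one p q n
  nlinarith

end Count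

theorem stmt_9 (F : Type*) [Field F] [Fintype F]
    (p q : Polynomial F) (hco : IsCoprime p q)
    (hd2 : 2 ≤ max p.natDegree q.natDegree)
    (hdp : max p.natDegree q.natDegree < ringChar F)
    (L : ℝ) (hL : Filter.Tendsto (fun n : ℕ => FPPgeo F p q n) Filter.atTop (nhds L)) :
    Filter.liminf (fun k : ℕ =>
        (perCount F p q k : ℝ) / ((Fintype.card F : ℝ) ^ k + 1)) Filter.atTop ≤ L ∧
    ((∀ n : ℕ, 1 ≤ n → ∀ x : (PhiPoly F p q n).SplittingField,
        algebraicOver ((algebraMap (RatFunc F) (PhiPoly F p q n).SplittingField).comp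
          (RatFunc.C : F →+* RatFunc F)) x →
        ∃ c : F, ((algebraMap (RatFunc F) (PhiPoly F p q n).SplittingField).comp
          (RatFunc.C : F →+* RatFunc F)) c = x) →
      Filter.limsup (fun k : ℕ =>
          (perCount F p q k : ℝ) / ((Fintype.card F : ℝ) ^ k + 1)) Filter.atTop ≤ L) := by
  obtain ⟨r, hℓ, hcard⟩ := FiniteField.card F (ringChar F)
  set ℓ := ringChar F
  have : Fact ℓ.Prime := ⟨hℓ⟩
  have : CharP (AlgebraicClosure F) ℓ :=
    charP_of_injective_algebraMap (algebraMap F (AlgebraicClosure F)).injective ℓ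
  have hr : 1 ≤ (r : ℕ) := r.pos
  have hd : 1 ≤ max p.natDegree q.natDegree := one_le_two.trans hd2
  have hn : ∀ {ε : ℝ}, 0 < ε → ∃ n : ℕ, 1 ≤ n ∧ FPPgeo F p q n ≤ L + ε := fun hε => by
    obtain ⟨n, h1, h2⟩ := ((hL.eventually_le_const (lt_add_of_pos_right L hε)).and
      (Filter.eventually_ge_atTop 1)).exists
    exact ⟨n, h2, h1⟩
  have hbdd : Filter.IsBoundedUnder (· ≥ ·) Filter.atTop (fun k : ℕ =>
      (perCount F p q k : ℝ) / ((Fintype.card F : ℝ) ^ k + 1)) :=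
    Filter.isBoundedUnder_of ⟨0, fun k => by positivity⟩
  refine ⟨le_of_forall_pos_le_add fun ε hε => ?_, fun hgeo => le_of_forall_pos_le_add fun ε hε => ?_⟩
  · obtain ⟨n, -, hnL⟩ := hn (half_pos hε)
    obtain ⟨M, hM, hτ⟩ := exists_semilinear_fixing_roots (E := RatFunc (AlgebraicClosure F))
      (K := geomField p q n) (geomNumerator p q n) (p := ℓ) (r := r) (by
        rw [map_iterNumerator, map_map, map_map,
          show (iterateFrobenius (AlgebraicClosure F) ℓ r).comp
            (algebraMap F (AlgebraicClosure F)) = algebraMap F (AlgebraicClosure F) from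
            RingHom.ext fun c => by
              simpa using iterateFrobenius_algebraMap (k := AlgebraicClosure F) hcard 1 c])
    have h1 := eventually_perCount_div_le n hco hd hr hM hcard hτ (half_pos hε)
    refine Filter.liminf_le_of_frequently_le ?_ hbdd
    have h2 := (Filter.tendsto_id.const_mul_atTop' hM).frequently (f := fun j : ℕ => M * j)
      (p := fun k : ℕ => (perCount F p q k : ℝ) / ((Fintype.card F : ℝ) ^ k + 1) ≤
        FPPgeo F p q n + ε / 2) h1.frequently
    exact h2.mono fun k hk => hk.trans (by linarith)
  · obtain ⟨n, hn1, hnL⟩ := hn (half_pos hε)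
    have hC : (algebraMap F (PhiPoly F p q n).SplittingField) =
        (algebraMap (RatFunc F) (PhiPoly F p q n).SplittingField).comp
          (RatFunc.C : F →+* RatFunc F) := by
      rw [IsScalarTower.algebraMap_eq F (RatFunc F), RatFunc.algebraMap_eq_C]
    have hint : ∀ x : (PhiPoly F p q n).SplittingField, IsIntegral F x →
        x ∈ Set.range (algebraMap F (PhiPoly F p q n).SplittingField) := by
      rintro x ⟨P, hP, hPx⟩
      rw [hC] at hPx ⊢
      exact hgeo n hn1 x ⟨P, hP.ne_zero, hPx⟩
    have heq : geomNumerator p q n =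
        (iterNumerator p q n).map (mapRingHom (algebraMap F (AlgebraicClosure F))) :=
      (map_iterNumerator _ _ _ _).symm
    have : IsSplittingField (RatFunc (AlgebraicClosure F)) (geomField p q n)
        (((iterNumerator p q n).map (mapRingHom (algebraMap F (AlgebraicClosure F)))).map
          (algebraMap (AlgebraicClosure F)[X] (RatFunc (AlgebraicClosure F)))) := by
      rw [← heq]
      infer_instance
    let σ : AlgebraicClosure F →ₐ[F] AlgebraicClosure F :=
      { iterateFrobenius (AlgebraicClosure F) ℓ (r * 1) with
        commutes' := iterateFrobenius_algebraMap hcard 1 }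
    have hτ := exists_lift_fixing_roots (E := RatFunc (AlgebraicClosure F))
      (K := geomField p q n) (E₀ := RatFunc F) (L := (PhiPoly F p q n).SplittingField)
      (iterNumerator p q n) hint σ
    rw [← heq] at hτ
    have h1 := eventually_perCount_div_le n hco hd hr le_rfl hcard hτ (half_pos hε)
    refine Filter.limsup_le_of_le hbdd.isCoboundedUnder_le ?_
    filter_upwards [h1] with k hk
    rw [one_mul] at hk
    linarith
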